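/- arXiv:2305.02921 — 2 statements merged into one kernel-verified Lean document; each statement's English description precedes it below -/
import Mathlib

section
/- Let I ⊆ M_m be a nonempty decreasing monomial set and r = max_{f∈I} deg(f). Then the set of minimum-weight codewords of C(I) is W_{2^{m−r}}(C(I)) = ⋃_{f∈I_r} {ev(P) : P ∈ LTA(m,2)_f·f}, this union is disjoint (for distinct f,g ∈ I_r the evaluated orbits are disjoint), and consequently |W_{2^{m−r}}(C(I))| = Σ_{f∈I_r} 2^{r+|λ_f|}. -/
open Finset Pointwise

/-- Points of the affine space `F_2^m`. -/
abbrev Point (m : ℕ) := Fin m → ZMod 2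

/-- The ring `R_m = F_2[x_0,…,x_{m-1}]/(x_i^2 - x_i)`, identified with the ring of
functions `F_2^m → F_2` via the evaluation isomorphism `ev`. -/
abbrev Fn (m : ℕ) := Point m → ZMod 2

/-- The monomial `∏_{i ∈ S} x_i` (as the function it evaluates to). -/
def monFn (m : ℕ) (S : Finset (Fin m)) : Fn m := fun u => ∏ i ∈ S, u i

/-- Hamming weight of `ev(P)`: the number of points where `P` takes the value 1. -/
def wt (m : ℕ) (P : Fn m) : ℕ := (Finset.univ.filter fun u => P u = 1).card

/-- The monomial code `C(I)`: the `F_2`-span of the evaluations of the monomials in `I`. -/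
def code (m : ℕ) (I : Set (Finset (Fin m))) : Submodule (ZMod 2) (Fn m) :=
  Submodule.span (ZMod 2) (monFn m '' I)

/-- `f ≼_sh g` for monomials of equal degree: the sorted index lists compare entrywise. -/
def shLE (m : ℕ) (S T : Finset (Fin m)) : Prop :=
  S.card = T.card ∧
    ∀ (ℓ : ℕ) (hS : ℓ < (S.sort (· ≤ ·)).length) (hT : ℓ < (T.sort (· ≤ ·)).length),
      (S.sort (· ≤ ·)).get ⟨ℓ, hS⟩ ≤ (T.sort (· ≤ ·)).get ⟨ℓ, hT⟩

/-- `f ≼ g` iff there is a monomial `g*` with `f ≼_sh g* ≼_w g`. -/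
def pre (m : ℕ) (S T : Finset (Fin m)) : Prop :=
  ∃ U : Finset (Fin m), shLE m S U ∧ U ⊆ T

/-- A decreasing set of monomials. -/
def Decreasing (m : ℕ) (I : Set (Finset (Fin m))) : Prop :=
  ∀ f ∈ I, ∀ g : Finset (Fin m), pre m g f → g ∈ I

/-- The affine map `u ↦ B u + ε` on `F_2^m`. -/
def affMap (m : ℕ) (B : Fin m → Fin m → ZMod 2) (ε : Point m) (u : Point m) : Point m :=
  fun i => (∑ j, B i j * u j) + ε i

/-- `B` is lower triangular with unit diagonal. -/
def IsLT (m : ℕ) (B : Fin m → Fin m → ZMod 2) : Prop :=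
  (∀ i, B i i = 1) ∧ ∀ i j : Fin m, i < j → B i j = 0

/-- The action of `(B,ε) ∈ LTA(m,2)` on `R_m`: substitute `x_i ↦ x_i + Σ_{j<i} b_{i,j} x_j + ε_i`.
In the function representation this is precomposition with the affine map. -/
def act (m : ℕ) (B : Fin m → Fin m → ZMod 2) (ε : Point m) (P : Fn m) : Fn m :=
  fun u => P (affMap m B ε u)

/-- The orbit `LTA(m,2)·P`. -/
def orbit (m : ℕ) (P : Fn m) : Set (Fn m) :=
  {Q | ∃ B ε, IsLT m B ∧ Q = act m B ε P}

/-- Membership in the subgroup `LTA(m,2)_g` for the monomial `g` with index set `S`: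
`ε_i = 0` if `i ∉ ind(g)`, and `b_{i,j} = 0` (off the diagonal) if `i ∉ ind(g)` or `j ∈ ind(g)`. -/
def IsLTsub (m : ℕ) (S : Finset (Fin m)) (B : Fin m → Fin m → ZMod 2) (ε : Point m) : Prop :=
  IsLT m B ∧ (∀ i, i ∉ S → ε i = 0) ∧
    ∀ i j : Fin m, j ≠ i → (i ∉ S ∨ j ∈ S) → B i j = 0

/-- The orbit `LTA(m,2)_g · P` where `S = ind(g)`. -/
def orbitSub (m : ℕ) (S : Finset (Fin m)) (P : Fn m) : Set (Fn m) :=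
  {Q | ∃ B ε, IsLTsub m S B ε ∧ Q = act m B ε P}

/-- `λ_f(i) = |{j : j < i, j ∉ ind(f)}|` where `S = ind(f)`. -/
def lam (m : ℕ) (S : Finset (Fin m)) (i : Fin m) : ℕ :=
  (Finset.univ.filter fun j => j < i ∧ j ∉ S).card

/-- `|λ_f(g)| = Σ_{i ∈ ind(g)} λ_f(i)`. -/
def lamSum (m : ℕ) (S T : Finset (Fin m)) : ℕ := ∑ i ∈ T, lam m S i

/-- The affine form `c + Σ_i a_i x_i`. -/
def affForm (m : ℕ) (c : ZMod 2) (a : Point m) : Fn m := fun u => c + ∑ i, a i * u i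

/-- `deg(P) ≤ r`: `P` lies in the span of the (multilinear) monomials of degree at most `r`. -/
def degLE (m : ℕ) (P : Fn m) (r : ℕ) : Prop :=
  P ∈ Submodule.span (ZMod 2)
    {Q : Fn m | ∃ S : Finset (Fin m), S.card ≤ r ∧ Q = monFn m S}


theorem zmod_two_cases (a : ZMod 2) : a = 0 ∨ a = 1 := by
  revert a; decide

theorem zmod_two_ext {a b : ZMod 2} (h : a = 1 ↔ b = 1) : a = b := by
  revert a b; decide

section Weight

variable {m : ℕ}

theorem wt_eq_zero_iff (P : Fn m) : wt m P = 0 ↔ P = 0 := by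
  simp only [wt, Finset.card_eq_zero, Finset.filter_eq_empty_iff, Finset.mem_univ, true_imp_iff,
    funext_iff, Pi.zero_apply]
  exact forall_congr' fun u => by rcases zmod_two_cases (P u) with h | h <;> simp [h]

theorem wt_eq_sum (P : Fn m) : wt m P = ∑ u, if P u = 1 then 1 else 0 := by
  simp [wt]

theorem eq_of_support_subset_of_wt_le {P Q : Fn m} (h : ∀ u, P u = 1 → Q u = 1)
    (hw : wt m Q ≤ wt m P) : P = Q := by
  have hs : (univ.filter fun u => P u = 1) = univ.filter fun u => Q u = 1 :=
    Finset.eq_of_subset_of_card_le (Finset.monotone_filter_right _ fun u _ => h u) hw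
  funext u
  exact zmod_two_ext (by simpa using Finset.ext_iff.1 hs u)

theorem wt_add_add (P Q : Fn m) : wt m (P + Q) + 2 * wt m (P * Q) = wt m P + wt m Q := by
  simp only [wt_eq_sum, Finset.mul_sum, ← Finset.sum_add_distrib]
  refine Finset.sum_congr rfl fun u _ => ?_
  simp only [Pi.add_apply, Pi.mul_apply]
  rcases zmod_two_cases (P u) with hP | hP <;> rcases zmod_two_cases (Q u) with hQ | hQ <;>
    simp [hP, hQ, CharTwo.add_self_eq_zero]

end Weight

section Slice

variable {m : ℕ}

/-- Restriction of a function on `F_2^(m+1)` to the hyperplane where the last variable is `x`. -/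
def slice (m : ℕ) (x : ZMod 2) : Fn (m + 1) →ₗ[ZMod 2] Fn m :=
  LinearMap.funLeft (ZMod 2) (ZMod 2) fun u : Point m => (Fin.snoc u x : Point (m + 1))

theorem slice_apply (x : ZMod 2) (P : Fn (m + 1)) (u : Point m) :
    slice m x P u = P (Fin.snoc u x : Point (m + 1)) := rfl

theorem fn_ext_snoc {P Q : Fn (m + 1)}
    (h : ∀ (u : Point m) (x : ZMod 2),
      P (Fin.snoc u x : Point (m + 1)) = Q (Fin.snoc u x : Point (m + 1))) : P = Q := by
  funext u
  have := h (Fin.init u) (u (Fin.last m))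
  rwa [Fin.snoc_init_self] at this

theorem wt_slice (P : Fn (m + 1)) :
    wt (m + 1) P = wt m (slice m 0 P) + wt m (slice m 1 P) := by
  simp only [wt_eq_sum, slice_apply]
  rw [← (Fin.snocEquiv fun _ : Fin (m + 1) => ZMod 2).sum_comp, Fintype.sum_prod_type]
  exact Fin.sum_univ_two _

theorem monFn_map_castSucc (S : Finset (Fin m)) (u : Point m) (x : ZMod 2) :
    monFn (m + 1) (S.map Fin.castSuccEmb) (Fin.snoc u x : Point (m + 1)) = monFn m S u := by
  simp [monFn]

theorem last_notMem_map_castSucc (S : Finset (Fin m)) :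
    Fin.last m ∉ S.map Fin.castSuccEmb := by
  simp [Fin.castSucc_ne_last]

theorem monFn_insert_last (S : Finset (Fin m)) (u : Point m) (x : ZMod 2) :
    monFn (m + 1) (insert (Fin.last m) (S.map Fin.castSuccEmb)) (Fin.snoc u x : Point (m + 1)) =
      x * monFn m S u := by
  rw [← monFn_map_castSucc S u x, monFn, Finset.prod_insert (last_notMem_map_castSucc S),
    Fin.snoc_last, monFn]

theorem exists_eq_map_or_insert_last (S : Finset (Fin (m + 1))) :
    ∃ T : Finset (Fin m),
      S = T.map Fin.castSuccEmb ∨ S = insert (Fin.last m) (T.map Fin.castSuccEmb) := by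
  refine ⟨univ.filter fun i => i.castSucc ∈ S, ?_⟩
  by_cases h : Fin.last m ∈ S
  · right
    ext i
    induction i using Fin.lastCases <;> simp [h, Fin.castSucc_ne_last]
  · left
    ext i
    induction i using Fin.lastCases <;> simp [h, Fin.castSucc_ne_last]

end Slice

section Degree

variable {m : ℕ}

/-- The functions of degree less than `r`. -/
def degLT (m r : ℕ) : Submodule (ZMod 2) (Fn m) :=
  Submodule.span (ZMod 2) (monFn m '' {S | S.card < r})

theorem degLT_zero : degLT m 0 = ⊥ := by
  simp [degLT]

theorem slice_mem_degLT {r : ℕ} {P : Fn (m + 1)} (hP : P ∈ degLT (m + 1) r) (x : ZMod 2) :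
    slice m x P ∈ degLT m r := by
  suffices h : degLT (m + 1) r ≤ (degLT m r).comap (slice m x) from h hP
  refine Submodule.span_le.2 ?_
  rintro _ ⟨S, hS, rfl⟩
  obtain ⟨T, rfl | rfl⟩ := exists_eq_map_or_insert_last S
  · have : slice m x (monFn (m + 1) (T.map Fin.castSuccEmb)) = monFn m T :=
      funext fun u => monFn_map_castSucc T u x
    rw [SetLike.mem_coe, Submodule.mem_comap, this]
    exact Submodule.subset_span ⟨T, by simpa using hS, rfl⟩
  · have : slice m x (monFn (m + 1) (insert (Fin.last m) (T.map Fin.castSuccEmb))) =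
        x • monFn m T := funext fun u => monFn_insert_last T u x
    rw [SetLike.mem_coe, Submodule.mem_comap, this]
    refine Submodule.smul_mem _ _ (Submodule.subset_span ⟨T, ?_, rfl⟩)
    rw [Set.mem_ofPred_eq, Finset.card_insert_of_notMem (last_notMem_map_castSucc T),
      Finset.card_map] at hS
    exact Nat.lt_of_succ_lt hS

theorem slice_add_slice_mem_degLT {r : ℕ} {P : Fn (m + 1)} (hP : P ∈ degLT (m + 1) (r + 1)) :
    slice m 0 P + slice m 1 P ∈ degLT m r := by
  suffices h : degLT (m + 1) (r + 1) ≤ (degLT m r).comap (slice m 0 + slice m 1) from h hP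
  refine Submodule.span_le.2 ?_
  rintro _ ⟨S, hS, rfl⟩
  rw [SetLike.mem_coe, Submodule.mem_comap]
  obtain ⟨T, rfl | rfl⟩ := exists_eq_map_or_insert_last S
  · have : (slice m 0 + slice m 1) (monFn (m + 1) (T.map Fin.castSuccEmb)) = 0 :=
      funext fun u => by
        simp only [LinearMap.add_apply, Pi.add_apply, slice_apply, monFn_map_castSucc]
        exact CharTwo.add_self_eq_zero _
    rw [this]
    exact zero_mem _
  · have : (slice m 0 + slice m 1)
        (monFn (m + 1) (insert (Fin.last m) (T.map Fin.castSuccEmb))) = monFn m T :=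
      funext fun u => by
        simp [slice_apply, monFn_insert_last]
    rw [this]
    refine Submodule.subset_span ⟨T, ?_, rfl⟩
    rw [Set.mem_ofPred_eq, Finset.card_insert_of_notMem (last_notMem_map_castSucc T),
      Finset.card_map] at hS
    exact Nat.lt_of_succ_lt_succ hS

/-- The minimum distance bound for Reed-Muller codes. -/
theorem two_pow_le_wt_mul {r : ℕ} {P : Fn m} (hP : P ∈ degLT m (r + 1)) (h0 : P ≠ 0) :
    2 ^ m ≤ wt m P * 2 ^ r := by
  induction m generalizing r with
  | zero =>
    have := Nat.pos_of_ne_zero (mt (wt_eq_zero_iff P).1 h0)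
    exact Nat.mul_pos this (Nat.two_pow_pos r)
  | succ m ih =>
    have hQ := slice_add_slice_mem_degLT hP
    have h₀ := slice_mem_degLT hP 0
    have h₁ := slice_mem_degLT hP 1
    rw [wt_slice, add_mul]
    have one_zero {A : Fn m} (hA : A ∈ degLT m r) (hA0 : A ≠ 0) :
        2 ^ (m + 1) ≤ wt m A * 2 ^ r := by
      cases r with
      | zero => exact absurd (by simpa [degLT_zero] using hA) hA0
      | succ r =>
        have := ih hA hA0
        rw [pow_succ, pow_succ]
        linarith
    by_cases e₀ : slice m 0 P = 0
    · rw [e₀, zero_add] at hQ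
      have e₁ : slice m 1 P ≠ 0 := fun e₁ => h0 <| by
        rw [← wt_eq_zero_iff, wt_slice, e₀, e₁]
        simp [wt_eq_zero_iff]
      exact le_add_left (one_zero hQ e₁)
    · by_cases e₁ : slice m 1 P = 0
      · rw [e₁, add_zero] at hQ
        exact le_add_right (one_zero hQ e₀)
      · have := ih h₀ e₀
        have := ih h₁ e₁
        rw [pow_succ]
        linarith

end Degree

section Affine

variable {m : ℕ}

theorem act_monFn_eq_one_iff (S : Finset (Fin m)) (B : Fin m → Fin m → ZMod 2) (ε u : Point m) :
    act m B ε (monFn m S) u = 1 ↔ ∀ i ∈ S, affMap m B ε u i = 1 := by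
  simp only [act, monFn]
  constructor
  · intro h i hi
    refine (zmod_two_cases _).resolve_left fun h0 => ?_
    rw [Finset.prod_eq_zero hi h0] at h
    exact zero_ne_one h
  · exact Finset.prod_eq_one

theorem affMap_add_add (B : Fin m → Fin m → ZMod 2) (ε u v w : Point m) :
    affMap m B ε (u + v + w) = affMap m B ε u + affMap m B ε v + affMap m B ε w := by
  funext i
  simp only [affMap, Pi.add_apply, mul_add, Finset.sum_add_distrib]
  linear_combination -(CharTwo.add_self_eq_zero (ε i))

theorem IsLTsub.affMap_eq {S : Finset (Fin m)} {B : Fin m → Fin m → ZMod 2} {ε : Point m}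
    (h : IsLTsub m S B ε) {i : Fin m} (hi : i ∈ S) (u : Point m) :
    affMap m B ε u i = u i + ∑ j ∈ Sᶜ, B i j * u j + ε i := by
  simp only [affMap]
  rw [← Finset.sum_add_sum_compl S, Finset.sum_eq_single_of_mem i hi, h.1.1, one_mul]
  intro j hj hji
  rw [h.2.2 i j hji (Or.inr hj), zero_mul]

theorem IsLTsub.act_eq_one_iff {S : Finset (Fin m)} {B : Fin m → Fin m → ZMod 2} {ε : Point m}
    (h : IsLTsub m S B ε) (u : Point m) :
    act m B ε (monFn m S) u = 1 ↔ ∀ i ∈ S, u i = 1 + ∑ j ∈ Sᶜ, B i j * u j + ε i := by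
  rw [act_monFn_eq_one_iff]
  refine forall₂_congr fun i hi => ?_
  rw [h.affMap_eq hi]
  generalize ∑ j ∈ Sᶜ, B i j * u j = a
  generalize u i = b
  generalize ε i = c
  revert a b c; decide

/-- The point of the flat `act B ε (monFn S) = 1` whose coordinates outside `S` are those
of `z`. -/
def flatPoint (S : Finset (Fin m)) (B : Fin m → Fin m → ZMod 2) (ε z : Point m) : Point m :=
  fun i => if i ∈ S then 1 + ∑ j ∈ Sᶜ, B i j * z j + ε i else z i

theorem IsLTsub.act_flatPoint {S : Finset (Fin m)} {B : Fin m → Fin m → ZMod 2} {ε : Point m}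
    (h : IsLTsub m S B ε) (z : Point m) :
    act m B ε (monFn m S) (flatPoint S B ε z) = 1 := by
  rw [h.act_eq_one_iff]
  intro i hi
  rw [flatPoint, if_pos hi]
  congr 2
  refine Finset.sum_congr rfl fun j hj => ?_
  rw [flatPoint, if_neg (Finset.mem_compl.1 hj)]

/-- Every affine form agrees on a flat in reduced form with one not involving the pivots. -/
theorem IsLTsub.exists_reduced {S : Finset (Fin m)} {B : Fin m → Fin m → ZMod 2} {ε : Point m}
    (h : IsLTsub m S B ε) (a : Point m) (c : ZMod 2) :
    ∃ (b : Point m) (e : ZMod 2), (∀ j ∈ S, b j = 0) ∧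
      ∀ u, act m B ε (monFn m S) u = 1 → ∑ j, a j * u j + c = ∑ j, b j * u j + e := by
  refine ⟨fun j => if j ∈ S then 0 else a j + ∑ i ∈ S, a i * B i j,
    c + ∑ i ∈ S, a i * (1 + ε i), fun j hj => if_pos hj, fun u hu => ?_⟩
  rw [h.act_eq_one_iff] at hu
  rw [← Finset.sum_add_sum_compl S, ← Finset.sum_add_sum_compl S]
  have h₁ : ∑ i ∈ S, a i * u i =
      ∑ i ∈ S, a i * (1 + ε i) + ∑ j ∈ Sᶜ, (∑ i ∈ S, a i * B i j) * u j := by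
    simp only [Finset.sum_mul]
    rw [Finset.sum_comm, ← Finset.sum_add_distrib]
    refine Finset.sum_congr rfl fun i hi => ?_
    rw [hu i hi]
    simp only [mul_add, Finset.mul_sum, mul_assoc]
    ring
  have h₂ : ∑ j ∈ S, (if j ∈ S then 0 else a j + ∑ i ∈ S, a i * B i j) * u j = 0 :=
    Finset.sum_eq_zero fun j hj => by rw [if_pos hj, zero_mul]
  have h₃ : ∑ j ∈ Sᶜ, (if j ∈ S then 0 else a j + ∑ i ∈ S, a i * B i j) * u j =
      ∑ j ∈ Sᶜ, a j * u j + ∑ j ∈ Sᶜ, (∑ i ∈ S, a i * B i j) * u j := by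
    rw [← Finset.sum_add_distrib]
    refine Finset.sum_congr rfl fun j hj => ?_
    rw [if_neg (Finset.mem_compl.1 hj), add_mul]
  rw [h₁, h₂, h₃]
  ring

theorem IsLT.affMap_injective {B : Fin m → Fin m → ZMod 2} (h : IsLT m B) (ε : Point m) :
    Function.Injective (affMap m B ε) := by
  intro u v huv
  funext i
  induction i using WellFoundedLT.induction with
  | ind i ih =>
    have hi := congr_fun huv i
    simp only [affMap, add_left_inj] at hi
    rw [← Finset.add_sum_erase _ _ (Finset.mem_univ i),
      ← Finset.add_sum_erase _ _ (Finset.mem_univ i), h.1, one_mul, one_mul] at hi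
    have : ∑ j ∈ univ.erase i, B i j * u j = ∑ j ∈ univ.erase i, B i j * v j := by
      refine Finset.sum_congr rfl fun j hj => ?_
      rcases lt_or_gt_of_ne (Finset.ne_of_mem_erase hj) with hlt | hlt
      · rw [ih j hlt]
      · rw [h.2 i j hlt, zero_mul, zero_mul]
    rw [this] at hi
    exact add_right_cancel hi

theorem IsLT.wt_act {B : Fin m → Fin m → ZMod 2} (h : IsLT m B) (ε : Point m) (P : Fn m) :
    wt m (act m B ε P) = wt m P := by
  simp only [wt_eq_sum, act]
  exact Function.Bijective.sum_comp
    (Finite.injective_iff_bijective.1 (h.affMap_injective ε)) fun u => if P u = 1 then 1 else 0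

theorem wt_monFn (S : Finset (Fin m)) : wt m (monFn m S) = 2 ^ (m - S.card) := by
  have : (univ.filter fun u => monFn m S u = 1) =
      Fintype.piFinset fun i => if i ∈ S then ({1} : Finset (ZMod 2)) else univ := by
    ext u
    have hu : act m (fun i j => if i = j then 1 else 0) 0 (monFn m S) u = monFn m S u := by
      simp [act, monFn, affMap]
    rw [Finset.mem_filter, ← hu, act_monFn_eq_one_iff, Fintype.mem_piFinset]
    simp only [affMap, Finset.mem_univ, true_and]
    refine forall_congr' fun i => ?_
    by_cases hi : i ∈ S <;> simp [hi]
  rw [wt, this, Fintype.card_piFinset]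
  simp only [apply_ite Finset.card, Finset.card_singleton, Finset.card_univ, ZMod.card]
  rw [Finset.prod_ite, Finset.prod_const_one, one_mul, Finset.prod_const, Finset.filter_not,
    Finset.filter_mem_eq_inter, Finset.univ_inter, ← Finset.compl_eq_univ_sdiff,
    Finset.card_compl, Fintype.card_fin]

end Affine

section MinimumWeight

variable {m : ℕ}

/-- The extension by one row of the linear part of a lower triangular affine map. -/
def extendMatrix (B : Fin m → Fin m → ZMod 2) (b : Point m) : Fin (m + 1) → Fin (m + 1) → ZMod 2 :=
  Fin.snoc (fun i => (Fin.snoc (B i) 0 : Point (m + 1))) (Fin.snoc b 1 : Point (m + 1))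

theorem affMap_extend (B : Fin m → Fin m → ZMod 2) (b ε u : Point m) (e x : ZMod 2) :
    affMap (m + 1) (extendMatrix B b) (Fin.snoc ε e : Point (m + 1))
        (Fin.snoc u x : Point (m + 1)) =
      (Fin.snoc (affMap m B ε u) (x + (∑ j, b j * u j + e)) : Point (m + 1)) := by
  funext i
  induction i using Fin.lastCases with
  | last =>
    simp only [affMap, extendMatrix, Fin.sum_univ_castSucc, Fin.snoc_last, Fin.snoc_castSucc]
    ring
  | cast i =>
    simp [affMap, extendMatrix, Fin.sum_univ_castSucc]

theorem isLT_extend {B : Fin m → Fin m → ZMod 2} (h : IsLT m B) (b : Point m) :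
    IsLT (m + 1) (extendMatrix B b) := by
  constructor
  · intro i
    induction i using Fin.lastCases <;> simp [extendMatrix, h.1]
  · intro i j hij
    induction i using Fin.lastCases with
    | last => exact absurd hij (Fin.le_last j).not_gt
    | cast i =>
      induction j using Fin.lastCases with
      | last => simp [extendMatrix]
      | cast j => simpa [extendMatrix] using h.2 i j (by simpa using hij)

theorem IsLTsub.extend {S : Finset (Fin m)} {B : Fin m → Fin m → ZMod 2} {ε : Point m}
    (h : IsLTsub m S B ε) :
    IsLTsub (m + 1) (S.map Fin.castSuccEmb) (extendMatrix B 0) (Fin.snoc ε 0 : Point (m + 1)) := by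
  refine ⟨isLT_extend h.1 0, fun i hi => ?_, fun i j hij hS => ?_⟩
  · induction i using Fin.lastCases with
    | last => simp
    | cast i => simpa using h.2.1 i (by simpa using hi)
  · induction i using Fin.lastCases with
    | last =>
      induction j using Fin.lastCases with
      | last => exact absurd rfl hij
      | cast j => simp [extendMatrix]
    | cast i =>
      induction j using Fin.lastCases with
      | last => simp [extendMatrix]
      | cast j => simpa [extendMatrix] using h.2.2 i j (by simpa using hij) (by simpa using hS)

theorem IsLTsub.extend_insert {S : Finset (Fin m)} {B : Fin m → Fin m → ZMod 2} {ε : Point m}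
    (h : IsLTsub m S B ε) {b : Point m} (hb : ∀ j ∈ S, b j = 0) (e : ZMod 2) :
    IsLTsub (m + 1) (insert (Fin.last m) (S.map Fin.castSuccEmb)) (extendMatrix B b)
      (Fin.snoc ε e : Point (m + 1)) := by
  refine ⟨isLT_extend h.1 b, fun i hi => ?_, fun i j hij hS => ?_⟩
  · induction i using Fin.lastCases with
    | last => simp at hi
    | cast i => simpa using h.2.1 i (by simpa [Fin.castSucc_ne_last] using hi)
  · induction i using Fin.lastCases with
    | last =>
      induction j using Fin.lastCases with
      | last => exact absurd rfl hij
      | cast j =>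
        simpa [extendMatrix] using hb j (by simpa [Fin.castSucc_ne_last] using hS)
    | cast i =>
      induction j using Fin.lastCases with
      | last => simp [extendMatrix]
      | cast j =>
        simpa [extendMatrix] using
          h.2.2 i j (by simpa using hij) (by simpa [Fin.castSucc_ne_last] using hS)

theorem mem_orbitSub_map_castSucc {S : Finset (Fin m)} {A : Fn m}
    (hA : A ∈ orbitSub m S (monFn m S)) {P : Fn (m + 1)}
    (hP : ∀ (u : Point m) (x : ZMod 2), P (Fin.snoc u x : Point (m + 1)) = A u) :
    P ∈ orbitSub (m + 1) (S.map Fin.castSuccEmb) (monFn (m + 1) (S.map Fin.castSuccEmb)) := by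
  obtain ⟨B, ε, h, rfl⟩ := hA
  refine ⟨_, _, h.extend, fn_ext_snoc fun u x => ?_⟩
  rw [hP, act, act, affMap_extend, monFn_map_castSucc]

theorem mem_orbitSub_insert_last {S : Finset (Fin m)} {A : Fn m}
    (hA : A ∈ orbitSub m S (monFn m S)) {P : Fn (m + 1)} (b : Point m) (e : ZMod 2)
    (hb : ∀ j ∈ S, b j = 0)
    (hP : ∀ (u : Point m) (x : ZMod 2),
      P (Fin.snoc u x : Point (m + 1)) = (x + (∑ j, b j * u j + e)) * A u) :
    P ∈ orbitSub (m + 1) (insert (Fin.last m) (S.map Fin.castSuccEmb))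
      (monFn (m + 1) (insert (Fin.last m) (S.map Fin.castSuccEmb))) := by
  obtain ⟨B, ε, h, rfl⟩ := hA
  refine ⟨_, _, h.extend_insert hb e, fn_ext_snoc fun u x => ?_⟩
  rw [hP, act, act, affMap_extend, monFn_insert_last]

/-- A flat of half the size contained in a flat `Q = 1` is cut out by one affine equation,
which can be taken not to involve the pivots of `Q`. -/
theorem exists_eq_affine_mul {S T : Finset (Fin m)} {A Q : Fn m}
    (hA : A ∈ orbitSub m T (monFn m T)) (hQ : Q ∈ orbitSub m S (monFn m S))
    (hAQ : ∀ u, A u = 1 → Q u = 1) (hw : wt m Q = 2 * wt m A) (hA0 : A ≠ 0) :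
    ∃ (b : Point m) (e : ZMod 2), (∀ j ∈ S, b j = 0) ∧
      ∀ u, A u = (∑ j, b j * u j + e) * Q u := by
  obtain ⟨B, ε, h, rfl⟩ := hA
  obtain ⟨B', ε', h', rfl⟩ := hQ
  set A := act m B ε (monFn m T)
  set Q := act m B' ε' (monFn m S)
  have hpos : 0 < wt m A := Nat.pos_of_ne_zero (mt (wt_eq_zero_iff A).1 hA0)
  obtain ⟨v, hvQ, hv⟩ : ∃ v, Q v = 1 ∧ A v ≠ 1 := by
    by_contra! hcon
    have : wt m Q ≤ wt m A := Finset.card_le_card (Finset.monotone_filter_right _ fun u _ => hcon u)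
    omega
  obtain ⟨w, hw1⟩ : ∃ w, A w = 1 := by
    by_contra! hcon
    exact hA0 (funext fun u => (zmod_two_cases _).resolve_right (hcon u))
  rw [Ne, act_monFn_eq_one_iff] at hv
  push Not at hv
  obtain ⟨i, hi, hvi⟩ := hv
  obtain ⟨b, e, hb, hbe⟩ := h'.exists_reduced (B i) (ε i)
  refine ⟨b, e, hb, congr_fun (?_ : A = fun u => (∑ j, b j * u j + e) * Q u)⟩
  have hL (u : Point m) (hu : Q u = 1) : ∑ j, b j * u j + e = affMap m B ε u i := (hbe u hu).symm
  refine eq_of_support_subset_of_wt_le (fun u hu => ?_) ?_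
  · rw [hAQ u hu, hL u (hAQ u hu), (act_monFn_eq_one_iff ..).1 hu i hi, one_mul]
  have hmul {x y : ZMod 2} : x * y = 1 ↔ y = 1 ∧ x = 1 := by
    revert x y; decide
  have hflip : (univ.filter fun u => Q u = 1 ∧ affMap m B ε u i = 1).card ≤
      (univ.filter fun u => Q u = 1 ∧ affMap m B ε u i ≠ 1).card := by
    refine Finset.card_le_card_of_injOn (fun u => u + v + w) (fun u hu => ?_)
      fun u _ u' _ huu' => by simpa using huu'
    simp only [Finset.coe_filter, Finset.mem_univ, true_and, Set.mem_ofPred_eq] at hu ⊢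
    refine ⟨?_, ?_⟩
    · have hwQ := hAQ w hw1
      rw [act_monFn_eq_one_iff] at hwQ hvQ ⊢
      intro k hk
      rw [affMap_add_add, Pi.add_apply, Pi.add_apply, hwQ k hk, hvQ k hk,
        (act_monFn_eq_one_iff ..).1 hu.1 k hk]
      decide
    · rw [affMap_add_add, Pi.add_apply, Pi.add_apply, hu.2,
        (act_monFn_eq_one_iff ..).1 hw1 i hi, (zmod_two_cases _).resolve_right hvi]
      decide
  have hsplit := Finset.card_filter_add_card_filter_not (s := univ.filter fun u => Q u = 1)
    fun u => affMap m B ε u i = 1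
  rw [Finset.filter_filter, Finset.filter_filter] at hsplit
  have hwt : wt m (fun u => (∑ j, b j * u j + e) * Q u) =
      (univ.filter fun u => Q u = 1 ∧ affMap m B ε u i = 1).card := by
    rw [wt]
    congr 1
    refine Finset.filter_congr fun u _ => ?_
    rw [hmul]
    exact and_congr_right fun hu => by rw [hL u hu]
  rw [hwt]
  have : (univ.filter fun u => Q u = 1).card = 2 * wt m A := hw
  simp only [ne_eq] at hflip
  omega

/-- A function of degree at most `r` and weight `2^(m-r)` is the indicator of a flat, written in
reduced form. -/
theorem exists_mem_orbitSub {r : ℕ} {P : Fn m} (hP : P ∈ degLT m (r + 1))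
    (hw : wt m P * 2 ^ r = 2 ^ m) :
    ∃ S : Finset (Fin m), S.card = r ∧ P ∈ orbitSub m S (monFn m S) := by
  induction m generalizing r with
  | zero =>
    rw [pow_zero] at hw
    have hr : r = 0 := by simpa using Nat.eq_one_of_mul_eq_one_left hw
    subst hr
    refine ⟨∅, rfl, fun _ _ => 1, 0, ⟨⟨fun i => i.elim0, fun i => i.elim0⟩, fun i => i.elim0,
      fun i => i.elim0⟩, funext fun u => ?_⟩
    have hP0 : P ≠ 0 := fun h => by simp [(wt_eq_zero_iff P).2 h] at hw
    have : P u ≠ 0 := fun h => hP0 (funext fun v => by rw [Subsingleton.elim v u, h]; rfl)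
    simpa [act, monFn] using (zmod_two_cases _).resolve_left this
  | succ m ih =>
    have hQ := slice_add_slice_mem_degLT hP
    have h₀ := slice_mem_degLT hP 0
    have h₁ := slice_mem_degLT hP 1
    rw [wt_slice] at hw
    have hPx (u : Point m) (x : ZMod 2) : P (Fin.snoc u x : Point (m + 1)) =
        slice m 0 P u + x * (slice m 0 P u + slice m 1 P u) := by
      simp only [slice_apply]
      rcases zmod_two_cases x with rfl | rfl
      · simp
      · rw [one_mul, CharTwo.add_cancel_left]
    generalize slice m 0 P = A₀ at *
    generalize slice m 1 P = A₁ at *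
    have one_zero {A : Fn m} (hA : A ∈ degLT m r) (hA0 : wt m A * 2 ^ r = 2 ^ (m + 1)) :
        ∃ S : Finset (Fin m), S.card + 1 = r ∧ A ∈ orbitSub m S (monFn m S) := by
      cases r with
      | zero =>
        have : A = 0 := by simpa [degLT_zero] using hA
        rw [(wt_eq_zero_iff A).2 this, zero_mul] at hA0
        exact absurd hA0.symm (Nat.two_pow_pos _).ne'
      | succ r =>
        obtain ⟨S, hS, hAS⟩ := ih hA (by rw [pow_succ, pow_succ] at hA0; linarith)
        exact ⟨S, by rw [hS], hAS⟩
    have hcard (S : Finset (Fin m)) :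
        (insert (Fin.last m) (S.map Fin.castSuccEmb)).card = S.card + 1 := by
      rw [Finset.card_insert_of_notMem (last_notMem_map_castSucc S), Finset.card_map]
    by_cases e₀ : A₀ = 0
    · subst e₀
      rw [zero_add] at hQ
      rw [(wt_eq_zero_iff _).2 rfl, zero_add] at hw
      obtain ⟨S, hS, hA⟩ := one_zero hQ hw
      refine ⟨_, (hcard S).trans hS, mem_orbitSub_insert_last hA 0 0 (fun _ _ => rfl) ?_⟩
      intro u x
      simp [hPx]
    by_cases e₁ : A₁ = 0
    · subst e₁
      rw [add_zero] at hQ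
      rw [(wt_eq_zero_iff (0 : Fn m)).2 rfl, add_zero] at hw
      obtain ⟨S, hS, hA⟩ := one_zero hQ hw
      refine ⟨_, (hcard S).trans hS, mem_orbitSub_insert_last hA 0 1 (fun _ _ => rfl) ?_⟩
      intro u x
      simp [hPx]
      ring
    have w₀ := two_pow_le_wt_mul h₀ e₀
    have w₁ := two_pow_le_wt_mul h₁ e₁
    rw [pow_succ] at hw
    have w₀' : wt m A₀ * 2 ^ r = 2 ^ m := by linarith
    have w₁' : wt m A₁ * 2 ^ r = 2 ^ m := by linarith
    have w₀₁ : wt m A₀ = wt m A₁ :=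
      Nat.eq_of_mul_eq_mul_right (Nat.two_pow_pos r) (w₀'.trans w₁'.symm)
    obtain ⟨T, hT, hA₀⟩ := ih h₀ w₀'
    by_cases hQ0 : A₀ + A₁ = 0
    · refine ⟨T.map Fin.castSuccEmb, by rw [Finset.card_map, hT],
        mem_orbitSub_map_castSucc hA₀ fun u x => ?_⟩
      have : A₀ u + A₁ u = 0 := congr_fun hQ0 u
      rw [hPx, this, mul_zero, add_zero]
    cases r with
    | zero => exact absurd (by simpa [degLT_zero] using hQ) hQ0
    | succ r =>
      have wQ := two_pow_le_wt_mul hQ hQ0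
      have hsum := wt_add_add A₀ A₁
      rw [pow_succ] at w₀'
      have hle : 2 * wt m A₀ ≤ wt m (A₀ + A₁) :=
        Nat.le_of_mul_le_mul_right (by linarith) (Nat.two_pow_pos r)
      have hwQ : wt m (A₀ + A₁) = 2 * wt m A₀ := by omega
      have hdisj : A₀ * A₁ = 0 := (wt_eq_zero_iff _).1 (by omega)
      obtain ⟨S, hS, hQS⟩ := ih hQ (by rw [hwQ]; linarith)
      have hsub (u : Point m) (hu : A₀ u = 1) : (A₀ + A₁) u = 1 := by
        have : A₀ u * A₁ u = 0 := congr_fun hdisj u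
        rw [hu, one_mul] at this
        rw [Pi.add_apply, hu, this, add_zero]
      obtain ⟨b, e, hb, hbe⟩ := exists_eq_affine_mul hA₀ hQS hsub hwQ e₀
      refine ⟨_, by rw [hcard, hS], mem_orbitSub_insert_last hQS b e hb fun u x => ?_⟩
      rw [hPx, add_mul, ← hbe, add_comm]
      rfl

end MinimumWeight

section Coefficient

variable {m : ℕ}

/-- The coefficient of the monomial with index set `S`, by Möbius inversion. -/
def coeffFn (S : Finset (Fin m)) : Fn m →ₗ[ZMod 2] ZMod 2 :=
  ∑ u ∈ univ.filter (fun u : Point m => ∀ j, j ∉ S → u j = 0), LinearMap.proj u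

theorem coeffFn_apply (S : Finset (Fin m)) (P : Fn m) :
    coeffFn S P = ∑ u ∈ univ.filter (fun u : Point m => ∀ j, j ∉ S → u j = 0), P u := by
  simp [coeffFn]

theorem coeffFn_monFn_of_ne {S T : Finset (Fin m)} (h : T ≠ S) : coeffFn S (monFn m T) = 0 := by
  rw [coeffFn_apply]
  by_cases hTS : T ⊆ S
  · obtain ⟨i, hiS, hiT⟩ := Finset.exists_of_ssubset (hTS.ssubset_of_ne h)
    refine Finset.sum_involution (fun u _ => u + Pi.single i 1) ?_ ?_ ?_ ?_
    · intro u _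
      have : monFn m T (u + Pi.single i 1) = monFn m T u := by
        refine Finset.prod_congr rfl fun j hj => ?_
        have hji : j ≠ i := fun h => hiT (h ▸ hj)
        simp [hji]
      rw [this, CharTwo.add_self_eq_zero]
    · intro u _ _ hu
      have := congr_fun hu i
      simp at this
    · intro u hu
      simp only [Finset.mem_filter, Finset.mem_univ, true_and] at hu ⊢
      intro j hj
      have hji : j ≠ i := fun h => hj (h ▸ hiS)
      simp [hu j hj, hji]
    · intro u _
      funext j
      rw [Pi.add_apply, Pi.add_apply, add_assoc, CharTwo.add_self_eq_zero, add_zero]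
  · obtain ⟨i, hiT, hiS⟩ := Finset.not_subset.1 hTS
    refine Finset.sum_eq_zero fun u hu => Finset.prod_eq_zero hiT ?_
    exact (Finset.mem_filter.1 hu).2 i hiS

theorem coeffFn_of_mem_orbitSub {S : Finset (Fin m)} {P : Fn m}
    (hP : P ∈ orbitSub m S (monFn m S)) : coeffFn S P = 1 := by
  obtain ⟨B, ε, h, rfl⟩ := hP
  rw [coeffFn_apply, Finset.sum_eq_single (flatPoint S B ε 0)]
  · exact h.act_flatPoint 0
  · intro u hu hne
    refine (zmod_two_cases _).resolve_right fun h1 => hne (funext fun i => ?_)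
    rw [h.act_eq_one_iff] at h1
    have hu := (Finset.mem_filter.1 hu).2
    by_cases hi : i ∈ S
    · rw [flatPoint, if_pos hi, h1 i hi]
      congr 2
      exact Finset.sum_congr rfl fun j hj => by rw [hu j (Finset.mem_compl.1 hj), Pi.zero_apply]
    · rw [flatPoint, if_neg hi, hu i hi, Pi.zero_apply]
  · intro hn
    refine absurd (Finset.mem_filter.2 ⟨Finset.mem_univ _, fun j hj => ?_⟩) hn
    rw [flatPoint, if_neg hj, Pi.zero_apply]

theorem mem_of_mem_orbitSub_of_mem_code {I : Set (Finset (Fin m))} {S : Finset (Fin m)} {P : Fn m}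
    (hP : P ∈ orbitSub m S (monFn m S)) (hI : P ∈ code m I) : S ∈ I := by
  by_contra hS
  suffices h : code m I ≤ LinearMap.ker (coeffFn S) by
    have h0 : coeffFn S P = 0 := h hI
    rw [coeffFn_of_mem_orbitSub hP] at h0
    exact one_ne_zero h0
  refine Submodule.span_le.2 ?_
  rintro _ ⟨T, hT, rfl⟩
  exact coeffFn_monFn_of_ne fun h => hS (h ▸ hT)

end Coefficient

section Decreasing

variable {m : ℕ}

theorem shLE_of_card_filter_le {S T : Finset (Fin m)} (hc : S.card = T.card)
    (h : ∀ k, (S.filter (k ≤ ·)).card ≤ (T.filter (k ≤ ·)).card) : shLE m S T := by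
  refine ⟨hc, fun l hS hT => ?_⟩
  by_contra! hlt
  rw [Finset.length_sort] at hS hT
  set l' : Fin S.card := ⟨l, hS⟩
  set s := S.orderEmbOfFin rfl
  set t := T.orderEmbOfFin hc.symm
  have hlt : t l' < s l' := hlt
  have h₁ : (Finset.Ici l').card ≤ (S.filter (s l' ≤ ·)).card := by
    refine Finset.card_le_card_of_injOn s (fun i hi => ?_) s.injective.injOn
    exact Finset.mem_filter.2 ⟨Finset.orderEmbOfFin_mem _ _ _, s.monotone (Finset.mem_Ici.1 hi)⟩
  have h₂ : (T.filter (s l' ≤ ·)).card ≤ (Finset.Ioi l').card := by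
    rw [← Finset.card_image_of_injective (Finset.Ioi l') t.injective]
    refine Finset.card_le_card fun x hx => ?_
    obtain ⟨hxT, hx⟩ := Finset.mem_filter.1 hx
    obtain ⟨i, rfl⟩ : x ∈ Set.range t := by
      rw [Finset.range_orderEmbOfFin]
      exact hxT
    exact Finset.mem_image_of_mem t (Finset.mem_Ioi.2 (t.lt_iff_lt.1 (hlt.trans_le hx)))
  have h₃ : (Finset.Ioi l').card < (Finset.Ici l').card := by
    rw [← Finset.Ioi_insert, Finset.card_insert_of_notMem Finset.notMem_Ioi_self]
    exact Nat.lt_succ_self _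
  exact absurd (h (s l')) (by omega)

theorem pre_of_card_filter_le {S T : Finset (Fin m)}
    (h : ∀ k, (S.filter (k ≤ ·)).card ≤ (T.filter (k ≤ ·)).card) (hle : S.card ≤ T.card) :
    pre m S T := by
  induction T using Finset.induction_on_min with
  | empty =>
    rw [Finset.card_empty, Nat.le_zero, Finset.card_eq_zero] at hle
    subst hle
    exact ⟨∅, shLE_of_card_filter_le rfl fun _ => le_rfl, subset_rfl⟩
  | insert a T ha ih =>
    have haT : a ∉ T := fun h => (ha a h).false
    rcases hle.eq_or_lt with heq | hlt
    · exact ⟨_, shLE_of_card_filter_le heq h, subset_rfl⟩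
    rw [Finset.card_insert_of_notMem haT, Nat.lt_succ_iff] at hlt
    suffices hT : ∀ k, (S.filter (k ≤ ·)).card ≤ (T.filter (k ≤ ·)).card by
      obtain ⟨U, hU, hUT⟩ := ih hT hlt
      exact ⟨U, hU, hUT.trans (Finset.subset_insert a T)⟩
    intro k
    by_cases hk : k ≤ a
    · rw [Finset.filter_true_of_mem fun x hx => hk.trans (ha x hx).le]
      exact (Finset.card_filter_le _ _).trans hlt
    · have := h k
      rwa [Finset.filter_insert, if_neg hk] at this

theorem card_filter_insert_le {S T : Finset (Fin m)} {i j : Fin m} (hji : j ≤ i) (hi : i ∉ S)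
    (h : ∀ k, (T.filter (k ≤ ·)).card ≤ (S.filter (k ≤ ·)).card) (k : Fin m) :
    ((insert j T).filter (k ≤ ·)).card ≤ ((insert i S).filter (k ≤ ·)).card := by
  rw [Finset.filter_insert, Finset.filter_insert]
  split_ifs with h₁ h₂ h₂
  · rw [Finset.card_insert_of_notMem fun hm => hi (Finset.mem_filter.1 hm).1]
    exact (Finset.card_insert_le _ _).trans (Nat.succ_le_succ (h k))
  · exact absurd (h₁.trans hji) h₂
  · exact (h k).trans (Finset.card_le_card (Finset.subset_insert _ _))
  · exact h k

theorem mul_monFn (T : Finset (Fin m)) (j : Fin m) (u : Point m) :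
    u j * monFn m T u = monFn m (insert j T) u := by
  simp only [monFn]
  by_cases hj : j ∈ T
  · rw [Finset.insert_eq_of_mem hj, ← Finset.mul_prod_erase T _ hj, ← mul_assoc]
    congr 1
    generalize u j = a
    revert a; decide
  · rw [Finset.prod_insert hj]

theorem act_monFn_mem_span {B : Fin m → Fin m → ZMod 2} (hB : IsLT m B) (ε : Point m)
    (S : Finset (Fin m)) :
    act m B ε (monFn m S) ∈ Submodule.span (ZMod 2) (monFn m ''
      {T | (∀ k, (T.filter (k ≤ ·)).card ≤ (S.filter (k ≤ ·)).card) ∧ T.card ≤ S.card}) := by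
  induction S using Finset.induction_on with
  | empty => exact Submodule.subset_span ⟨∅, ⟨fun _ => le_rfl, le_rfl⟩, rfl⟩
  | insert i S hi ih =>
    have hmul : act m B ε (monFn m (insert i S)) =
        LinearMap.mulLeft (ZMod 2) (fun u => affMap m B ε u i : Fn m) (act m B ε (monFn m S)) :=
      funext fun u => Finset.prod_insert hi
    rw [hmul]
    rw [← Submodule.mem_comap]
    refine Submodule.span_le.2 ?_ ih
    rintro _ ⟨T, ⟨hT, hTc⟩, rfl⟩
    have hexp : LinearMap.mulLeft (ZMod 2) (fun u => affMap m B ε u i : Fn m) (monFn m T) =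
        ∑ j, B i j • monFn m (insert j T) + ε i • monFn m T := by
      funext u
      simp only [LinearMap.mulLeft_apply, Pi.mul_apply, affMap, add_mul, Finset.sum_mul,
        Pi.add_apply, Finset.sum_apply, Pi.smul_apply, smul_eq_mul, ← mul_monFn, mul_assoc]
    rw [SetLike.mem_coe, Submodule.mem_comap, hexp]
    refine Submodule.add_mem _ (Submodule.sum_mem _ fun j _ => ?_)
      (Submodule.smul_mem _ _ (Submodule.subset_span ⟨T, ⟨fun k => (hT k).trans ?_, ?_⟩, rfl⟩))
    · rcases lt_or_ge i j with hij | hij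
      · rw [hB.2 i j hij, zero_smul]
        exact zero_mem _
      · refine Submodule.smul_mem _ _ (Submodule.subset_span
          ⟨_, ⟨card_filter_insert_le hij hi hT, ?_⟩, rfl⟩)
        rw [Finset.card_insert_of_notMem hi]
        exact (Finset.card_insert_le _ _).trans (Nat.succ_le_succ hTc)
    · exact Finset.card_le_card (Finset.filter_subset_filter _ (Finset.subset_insert _ _))
    · exact hTc.trans (Finset.card_le_card (Finset.subset_insert _ _))

theorem act_monFn_mem_code {I : Set (Finset (Fin m))} (hI : Decreasing m I) {S : Finset (Fin m)}
    (hS : S ∈ I) {B : Fin m → Fin m → ZMod 2} (hB : IsLT m B) (ε : Point m) :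
    act m B ε (monFn m S) ∈ code m I :=
  Submodule.span_mono (Set.image_mono fun T hT => hI S hS T (pre_of_card_filter_le hT.1 hT.2))
    (act_monFn_mem_span hB ε S)

end Decreasing

section Count

variable {m : ℕ}

theorem flatPoint_add_single (S : Finset (Fin m)) (B : Fin m → Fin m → ZMod 2) (ε : Point m)
    {i j : Fin m} (hi : i ∈ S) (hj : j ∉ S) :
    flatPoint S B ε (Pi.single j 1) i = flatPoint S B ε 0 i + B i j := by
  simp only [flatPoint, if_pos hi]
  rw [Finset.sum_eq_single_of_mem j (Finset.mem_compl.2 hj)]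
  · simp
    ring
  · intro k _ hk
    simp [hk]

theorem IsLTsub.eq_of_act_eq {S : Finset (Fin m)} {B B' : Fin m → Fin m → ZMod 2} {ε ε' : Point m}
    (h : IsLTsub m S B ε) (h' : IsLTsub m S B' ε')
    (heq : act m B ε (monFn m S) = act m B' ε' (monFn m S)) : B = B' ∧ ε = ε' := by
  have hflat (z : Point m) : flatPoint S B ε z = flatPoint S B' ε' z := by
    have := h.act_flatPoint z
    rw [heq, h'.act_eq_one_iff] at this
    funext i
    by_cases hi : i ∈ S
    · rw [this i hi, flatPoint, if_pos hi]
      congr 2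
      refine Finset.sum_congr rfl fun j hj => ?_
      rw [flatPoint, if_neg (Finset.mem_compl.1 hj)]
    · rw [flatPoint, flatPoint, if_neg hi, if_neg hi]
  constructor
  · funext i j
    by_cases hij : j = i
    · rw [hij, h.1.1, h'.1.1]
    by_cases hS : i ∉ S ∨ j ∈ S
    · rw [h.2.2 i j hij hS, h'.2.2 i j hij hS]
    · push Not at hS
      have := congr_fun (hflat (Pi.single j 1)) i
      rwa [flatPoint_add_single S B ε hS.1 hS.2, flatPoint_add_single S B' ε' hS.1 hS.2,
        hflat 0, add_right_inj] at this
  · funext i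
    by_cases hi : i ∈ S
    · simpa [flatPoint, hi] using congr_fun (hflat 0) i
    · rw [h.2.1 i hi, h'.2.1 i hi]

theorem subset_of_mem_orbitSub {S T : Finset (Fin m)} {P : Fn m}
    (hS : P ∈ orbitSub m S (monFn m S)) (hT : P ∈ orbitSub m T (monFn m T)) : S ⊆ T := by
  obtain ⟨B, ε, h, rfl⟩ := hS
  obtain ⟨B', ε', h', heq⟩ := hT
  intro i hi
  by_contra hiT
  have h₀ := h'.act_flatPoint 0
  have h₁ := h'.act_flatPoint (Pi.single i 1)
  rw [← heq, h.act_eq_one_iff] at h₀ h₁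
  have hagree : ∀ k < i, flatPoint T B' ε' (Pi.single i 1) k = flatPoint T B' ε' 0 k := by
    intro k hk
    by_cases hkT : k ∈ T
    · rw [flatPoint_add_single T B' ε' hkT hiT, h'.1.2 k i hk, add_zero]
    · simp [flatPoint, hkT, hk.ne]
  have hsum : ∑ j ∈ Sᶜ, B i j * flatPoint T B' ε' (Pi.single i 1) j =
      ∑ j ∈ Sᶜ, B i j * flatPoint T B' ε' 0 j := by
    refine Finset.sum_congr rfl fun j hj => ?_
    rcases lt_trichotomy j i with hlt | rfl | hlt
    · rw [hagree j hlt]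
    · exact absurd hi (Finset.mem_compl.1 hj)
    · rw [h.1.2 i j hlt, zero_mul, zero_mul]
  have := (h₁ i hi).trans ((congrArg (1 + · + ε i) hsum).trans (h₀ i hi).symm)
  simp [flatPoint, hiT] at this

theorem ncard_orbitSub (S : Finset (Fin m)) :
    (orbitSub m S (monFn m S)).ncard = 2 ^ (S.card + lamSum m S S) := by
  let E : Finset (Point m) := Fintype.piFinset fun i => if i ∈ S then univ else {0}
  let M : Finset (Fin m → Fin m → ZMod 2) := Fintype.piFinset fun i => Fintype.piFinset fun j =>
    if j = i then {1} else if i ∈ S ∧ j < i ∧ j ∉ S then univ else {0}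
  have hmem (p : (Fin m → Fin m → ZMod 2) × Point m) : p ∈ M ×ˢ E ↔ IsLTsub m S p.1 p.2 := by
    rw [Finset.mem_product, Fintype.mem_piFinset, Fintype.mem_piFinset]
    simp only [Fintype.mem_piFinset]
    constructor
    · rintro ⟨hB, hε⟩
      refine ⟨⟨fun i => by simpa using hB i i, fun i j hij => ?_⟩, fun i hi => ?_,
        fun i j hij hS => ?_⟩
      · simpa [hij.ne', hij.not_gt] using hB i j
      · simpa [hi] using hε i
      · have := hB i j
        rwa [if_neg hij, if_neg (by tauto), Finset.mem_singleton] at this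
    · intro h
      refine ⟨fun i j => ?_, fun i => ?_⟩
      · split_ifs with h₁ h₂
        · rw [h₁, h.1.1]
          simp
        · exact Finset.mem_univ _
        · rw [Finset.mem_singleton]
          by_cases hS : i ∉ S ∨ j ∈ S
          · exact h.2.2 i j h₁ hS
          · refine h.1.2 i j (lt_of_le_of_ne (not_lt.1 fun hlt => h₂ ?_) (Ne.symm h₁))
            tauto
      · split_ifs with hi
        · exact Finset.mem_univ _
        · simpa using h.2.1 i hi
  have himage : orbitSub m S (monFn m S) =
      (fun p : (Fin m → Fin m → ZMod 2) × Point m => act m p.1 p.2 (monFn m S)) '' ↑(M ×ˢ E) := by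
    ext P
    constructor
    · rintro ⟨B, ε, h, rfl⟩
      exact ⟨(B, ε), (hmem (B, ε)).2 h, rfl⟩
    · rintro ⟨p, hp, rfl⟩
      exact ⟨p.1, p.2, (hmem p).1 hp, rfl⟩
  have hE : E.card = 2 ^ S.card := by
    simp only [E, Fintype.card_piFinset, apply_ite Finset.card, Finset.card_singleton,
      Finset.card_univ, ZMod.card]
    simp
  have hM : M.card = 2 ^ lamSum m S S := by
    simp only [M, Fintype.card_piFinset, apply_ite Finset.card, Finset.card_singleton,
      Finset.card_univ, ZMod.card]
    rw [lamSum, ← Finset.prod_pow_eq_pow_sum, ← Finset.prod_subset (Finset.subset_univ S)]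
    · refine Finset.prod_congr rfl fun i hi => ?_
      rw [lam, ← Finset.prod_const, Finset.prod_filter]
      refine Finset.prod_congr rfl fun j _ => ?_
      by_cases hij : j = i <;> simp [hij, hi]
    · intro i _ hi
      simp [hi]
  rw [himage, Set.InjOn.ncard_image, Set.ncard_coe_finset, Finset.card_product, hM, hE, pow_add,
    mul_comm]
  intro p hp q hq hpq
  have := ((hmem p).1 hp).eq_of_act_eq ((hmem q).1 hq) hpq
  exact Prod.ext this.1 this.2

end Count

/-- the minimum-weight codewords of `C(I)` are exactly the evaluations of the
orbits `LTA(m,2)_f·f`, `f ∈ I_r`; distinct orbits are disjoint; and the count is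
`Σ_{f ∈ I_r} 2^(r+|λ_f|)`. -/
theorem stmt4 (m : ℕ) (hm : 1 ≤ m) (I : Finset (Finset (Fin m))) (hne : I.Nonempty)
    (hdec : Decreasing m ↑I) (r : ℕ) (hub : ∀ f ∈ I, f.card ≤ r)
    (hmax : ∃ f ∈ I, f.card = r) :
    ({c : Fn m | c ∈ code m ↑I ∧ wt m c = 2 ^ (m - r)} =
        ⋃ f ∈ I.filter (fun f => f.card = r), orbitSub m f (monFn m f)) ∧
    (∀ f ∈ I.filter (fun f => f.card = r), ∀ g ∈ I.filter (fun f => f.card = r), f ≠ g →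
        Disjoint (orbitSub m f (monFn m f)) (orbitSub m g (monFn m g))) ∧
    ({c : Fn m | c ∈ code m ↑I ∧ wt m c = 2 ^ (m - r)}.ncard =
        ∑ f ∈ I.filter (fun f => f.card = r), 2 ^ (r + lamSum m f f)) := by
  have hcode : code m ↑I ≤ degLT m (r + 1) :=
    Submodule.span_mono (Set.image_mono fun f hf => Nat.lt_succ_of_le (hub f hf))
  have hrm : r ≤ m := by
    obtain ⟨f, -, rfl⟩ := hmax
    simpa using Finset.card_le_univ f
  have hunion : {c : Fn m | c ∈ code m ↑I ∧ wt m c = 2 ^ (m - r)} =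
      ⋃ f ∈ I.filter (fun f => f.card = r), orbitSub m f (monFn m f) := by
    ext P
    simp only [Set.mem_ofPred_eq, Set.mem_iUnion, Finset.mem_filter, exists_prop]
    constructor
    · rintro ⟨hP, hw⟩
      obtain ⟨S, hS, hPS⟩ := exists_mem_orbitSub (hcode hP)
        (by rw [hw, ← pow_add, Nat.sub_add_cancel hrm])
      exact ⟨S, ⟨mem_of_mem_orbitSub_of_mem_code hPS hP, hS⟩, hPS⟩
    · rintro ⟨S, ⟨hSI, hS⟩, B, ε, h, rfl⟩
      exact ⟨act_monFn_mem_code hdec hSI h.1 ε, by rw [h.1.wt_act, wt_monFn, hS]⟩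
  have hdisj : ∀ f ∈ I.filter (fun f => f.card = r), ∀ g ∈ I.filter (fun f => f.card = r), f ≠ g →
      Disjoint (orbitSub m f (monFn m f)) (orbitSub m g (monFn m g)) := fun f _ g _ hfg =>
    Set.disjoint_left.2 fun P hf hg =>
      hfg ((subset_of_mem_orbitSub hf hg).antisymm (subset_of_mem_orbitSub hg hf))
  refine ⟨hunion, hdisj, ?_⟩
  rw [hunion]
  have hcard := (I.filter fun f : Finset (Fin m) => f.card = r).finite_toSet.ncard_biUnion
    (fun f _ => Set.toFinite (orbitSub m f (monFn m f)))
    fun f hf g hg hfg => hdisj f hf g hg hfg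
  rw [finsum_mem_coe_finset] at hcard
  refine hcard.trans (Finset.sum_congr rfl fun f hf => ?_)
  rw [ncard_orbitSub, (Finset.mem_filter.1 hf).2]
end

section
/- (Kasami–Tokura classification below twice the minimum weight) Let r < m and let P ∈ R_m satisfy deg(P) ≤ r and 0 < w(ev(P)) < 2^{m+1−r}. Then P can be written in at least one of the following forms, for linearly independent affine forms y_i ∈ R_m: (0) P = y_1⋯y_r, in which case w(ev(P)) = 2^{m−r}; (1) P = y_1⋯y_{r−μ}(y_{r−μ+1}⋯y_r + y_{r+1}⋯y_{r+μ}) for some μ with 3 ≤ μ ≤ r and m ≥ r+μ; (2) P = y_1⋯y_{r−2}(y_{r−1}y_r + ⋯ + y_{r+2μ−3}y_{r+2μ−2}) for some μ ≥ 2 with 2μ ≤ m−r+2. In cases (1) and (2), w(ev(P)) = 2^{m+1−r} − 2^{m+1−r−μ}. -/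
open Finset Pointwise

namespace KasamiTokura
open Module
set_option linter.unusedSectionVars false
universe u

section Degree

variable {V W : Type*} [AddCommGroup V] [Module (ZMod 2) V] [AddCommGroup W] [Module (ZMod 2) W]

theorem eq_zero_or_one (t : ZMod 2) : t = 0 ∨ t = 1 := by
  revert t; decide

theorem add_self_zmod (t : ZMod 2) : t + t = 0 := CharTwo.add_self_eq_zero t

theorem add_self_module (x : V) : x + x = 0 := by
  rw [← two_smul (ZMod 2) x, show (2 : ZMod 2) = 0 from rfl, zero_smul]

/-- The derivative of `f` in direction `a`. -/
def derivative (a : V) (f : V → ZMod 2) : V → ZMod 2 := fun x => f (x + a) + f x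

/-- `f` has degree at most `r`, expressed through iterated derivatives. -/
def DegreeLE : ℕ → (V → ZMod 2) → Prop
  | 0, f => ∀ x y, f x = f y
  | r + 1, f => ∀ a, DegreeLE r (derivative a f)

theorem DegreeLE.comp {r : ℕ} {f : V → ZMod 2} (hf : DegreeLE r f) (L : W →ₗ[ZMod 2] V) (b : V) :
    DegreeLE r (fun w => f (L w + b)) := by
  induction r generalizing f with
  | zero => exact fun x y => hf _ _
  | succ r ih =>
    intro a
    have h := ih (hf (L a))
    convert h using 1
    funext w
    simp only [derivative, map_add]
    rw [add_right_comm]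

theorem DegreeLE.translate {r : ℕ} {f : V → ZMod 2} (hf : DegreeLE r f) (b : V) :
    DegreeLE r (fun x => f (x + b)) := hf.comp LinearMap.id b

theorem DegreeLE.add {r : ℕ} {f g : V → ZMod 2} (hf : DegreeLE r f) (hg : DegreeLE r g) :
    DegreeLE r (fun x => f x + g x) := by
  induction r generalizing f g with
  | zero => exact fun x y => congrArg₂ _ (hf x y) (hg x y)
  | succ r ih =>
    intro a
    convert ih (hf a) (hg a) using 1
    funext x
    simp only [derivative]
    ring

theorem degreeLE_const (r : ℕ) (c : ZMod 2) : DegreeLE r (fun _ : V => c) := by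
  induction r generalizing c with
  | zero => exact fun _ _ => rfl
  | succ r ih => exact fun a => ih (c + c)

theorem DegreeLE.succ {r : ℕ} {f : V → ZMod 2} (hf : DegreeLE r f) : DegreeLE (r + 1) f := by
  induction r generalizing f with
  | zero => exact fun a x y => by simp only [derivative, hf (x + a) (y + a), hf x y]
  | succ r ih => exact fun a => ih (hf a)

theorem DegreeLE.mono {r s : ℕ} (hrs : r ≤ s) {f : V → ZMod 2} (hf : DegreeLE r f) :
    DegreeLE s f := by
  induction hrs with
  | refl => exact hf
  | step _ ih => exact ih.succ

theorem DegreeLE.mul_form {r : ℕ} {f : V → ZMod 2} (hf : DegreeLE r f) (φ : Dual (ZMod 2) V) :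
    DegreeLE (r + 1) (fun x => φ x * f x) := by
  induction r generalizing f with
  | zero =>
    intro a x y
    simp only [derivative, map_add, hf (x + a) 0, hf (y + a) 0, hf x 0, hf y 0]
    linear_combination (φ x - φ y) * add_self_zmod (f 0)
  | succ r ih =>
    intro a
    have h1 := ih (hf a)
    have h2 : DegreeLE (r + 1) (fun x => φ a * f (x + a)) := by
      rcases eq_zero_or_one (φ a) with h | h
      · simpa [h] using degreeLE_const (V := V) (r + 1) 0
      · simpa [h] using hf.translate a
    convert h1.add h2 using 1
    funext x
    simp only [derivative, map_add]
    ring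

theorem DegreeLE.exists_affine {f : V → ZMod 2} (hf : DegreeLE 1 f) :
    ∃ φ : Dual (ZMod 2) V, ∀ x, f x = f 0 + φ x := by
  have hadd : ∀ x y, f (x + y) + f 0 = (f x + f 0) + (f y + f 0) := by
    intro x y
    have h : f (x + y) + f x = f (0 + y) + f 0 := hf y x 0
    rw [zero_add] at h
    linear_combination h - add_self_zmod (f x)
  let φ : V →+ ZMod 2 := AddMonoidHom.mk' (fun x => f x + f 0) hadd
  refine ⟨φ.toZModLinearMap 2, fun x => ?_⟩
  change f x = f 0 + (f x + f 0)
  linear_combination -add_self_zmod (f 0)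

end Degree

section Weight

variable {V : Type*} [AddCommGroup V] [Module (ZMod 2) V] [Fintype V]

/-- The Hamming weight of a function. -/
def weight (f : V → ZMod 2) : ℕ := ∑ x, (f x).val

theorem val_add_val (s t : ZMod 2) : (s + t).val + 2 * (s * t).val = s.val + t.val := by
  revert s t; decide

theorem weight_add (f g : V → ZMod 2) :
    weight (fun x => f x + g x) + 2 * weight (fun x => f x * g x) = weight f + weight g := by
  simp only [weight, mul_sum, ← sum_add_distrib, val_add_val]

theorem weight_translate (f : V → ZMod 2) (b : V) : weight (fun x => f (x + b)) = weight f :=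
  Fintype.sum_equiv (Equiv.addRight b) _ _ fun _ => rfl

theorem weight_eq_zero {f : V → ZMod 2} : weight f = 0 ↔ ∀ x, f x = 0 := by
  simp [weight, ZMod.val_eq_zero]

theorem card_linear_fiber {ι : Type*} [Fintype ι] {z : ι → Dual (ZMod 2) V}
    (hz : LinearIndependent (ZMod 2) z) (c : ι → ZMod 2) :
    weight (fun x => ∏ i, (c i + z i x)) * 2 ^ Fintype.card ι = Fintype.card V := by
  classical
  let T : V →ₗ[ZMod 2] (ι → ZMod 2) := LinearMap.pi z
  have hT : Function.Surjective T := by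
    rw [← LinearMap.range_eq_top]
    by_contra hne
    obtain ⟨g, hg, hle⟩ := Submodule.exists_le_ker_of_lt_top _ (lt_top_iff_ne_top.2 hne)
    apply hg
    have hsum : ∑ i, g (Pi.single i 1) • z i = 0 := by
      ext x
      have : g (T x) = 0 := hle ⟨x, rfl⟩
      rw [LinearMap.pi_apply_eq_sum_univ g (T x)] at this
      simp only [LinearMap.sum_apply, LinearMap.smul_apply, LinearMap.zero_apply, smul_eq_mul]
      rw [← this]
      refine Finset.sum_congr rfl fun i _ => ?_
      simp only [T, LinearMap.pi_apply, smul_eq_mul]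
      rw [mul_comm]
      congr 2
      funext j
      simp [Pi.single_apply, eq_comm]
    have h0 := Fintype.linearIndependent_iff.1 hz _ hsum
    apply LinearMap.pi_ext'
    intro i
    ext
    simpa using h0 i
  have hw : ∀ v : ι → ZMod 2, #{x | T x = v} = weight (fun x => ∏ i, (c i + z i x)) := by
    intro v
    have h1 : weight (fun x => ∏ i, (c i + z i x)) = #{x | T x = fun i => c i + 1} := by
      rw [weight, Finset.card_filter]
      refine Finset.sum_congr rfl fun x _ => ?_
      split_ifs with h
      · have : ∀ i, c i + z i x = 1 := fun i => by
          have := congrFun h i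
          simp only [T, LinearMap.pi_apply] at this
          rw [this]; linear_combination add_self_zmod (c i)
        simp [this, ZMod.val_one]
      · rw [ZMod.val_eq_zero]
        obtain ⟨i, hi⟩ := Function.ne_iff.1 h
        refine Finset.prod_eq_zero (mem_univ i) ?_
        rcases eq_zero_or_one (c i + z i x) with h' | h'
        · exact h'
        · refine absurd ?_ hi
          simp only [T, LinearMap.pi_apply]
          linear_combination h' - add_self_zmod (c i)
    rw [h1]
    obtain ⟨p, hp⟩ := hT v
    obtain ⟨q, hq⟩ := hT (fun i => c i + 1)
    refine Finset.card_bij (fun x _ => x - p + q) ?_ ?_ ?_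
    · simp only [mem_filter, mem_univ, true_and, map_add, map_sub, hp, hq]
      intro x hx; simp [hx]
    · intro x _ y _ h; simpa using h
    · simp only [mem_filter, mem_univ, true_and]
      intro y hy
      exact ⟨y - q + p, by simp [hp, hq, hy], by abel⟩
  have := Finset.card_eq_sum_card_fiberwise (f := T) (s := univ) (t := univ) (fun x _ => mem_univ _)
  simp only [hw, sum_const, smul_eq_mul, card_univ, Fintype.card_fun, ZMod.card] at this
  rw [this, mul_comm]

end Weight

section Splitting

variable {V : Type*} [AddCommGroup V] [Module (ZMod 2) V]

/-- The projection onto the kernel of `φ` along a vector `a` with `φ a = 1`. -/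
def proj (φ : Dual (ZMod 2) V) (a : V) (ha : φ a = 1) : V →ₗ[ZMod 2] LinearMap.ker φ :=
  LinearMap.codRestrict _ (LinearMap.id + φ.smulRight a) fun x => by
    simp [ha, add_self_zmod]

theorem coe_proj {φ : Dual (ZMod 2) V} {a : V} (ha : φ a = 1) (x : V) :
    (proj φ a ha x : V) = x + φ x • a := rfl

theorem proj_coe {φ : Dual (ZMod 2) V} {a : V} (ha : φ a = 1) (w : LinearMap.ker φ) :
    proj φ a ha w = w := by
  ext
  simp [coe_proj]

theorem proj_self {φ : Dual (ZMod 2) V} {a : V} (ha : φ a = 1) : proj φ a ha a = 0 := by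
  ext
  simp [coe_proj, ha, add_self_module]

theorem proj_coe_add {φ : Dual (ZMod 2) V} {a : V} (ha : φ a = 1) (w : LinearMap.ker φ) :
    proj φ a ha (w + a) = w := by
  rw [map_add, proj_coe, proj_self, add_zero]

theorem proj_surjective {φ : Dual (ZMod 2) V} {a : V} (ha : φ a = 1) :
    Function.Surjective (proj φ a ha) := fun w => ⟨w, proj_coe ha w⟩

theorem exists_apply_eq_one {φ : Dual (ZMod 2) V} (hφ : φ ≠ 0) : ∃ a, φ a = 1 := by
  by_contra! h
  exact hφ (LinearMap.ext fun x => (eq_zero_or_one (φ x)).resolve_right (h x))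

theorem apply_coe_ker {φ : Dual (ZMod 2) V} (w : LinearMap.ker φ) : φ w = 0 := w.2

theorem apply_coe_ker_add {φ : Dual (ZMod 2) V} {a : V} (ha : φ a = 1) (w : LinearMap.ker φ) :
    φ (w + a) = 1 := by
  rw [map_add, apply_coe_ker, ha, zero_add]

/-- Functions agree if they agree on both cosets of the kernel of `φ`. -/
theorem forall_of_cosets {φ : Dual (ZMod 2) V} {a : V} (ha : φ a = 1) {p : V → Prop}
    (h0 : ∀ w : LinearMap.ker φ, p w) (h1 : ∀ w : LinearMap.ker φ, p (w + a)) (x : V) : p x := by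
  have hx := coe_proj ha x
  rcases eq_zero_or_one (φ x) with h | h
  · have := h0 (proj φ a ha x)
    rwa [hx, h, zero_smul, add_zero] at this
  · have := h1 (proj φ a ha x)
    rwa [hx, h, one_smul, add_assoc, add_self_module, add_zero] at this

theorem sum_split [Fintype V] {φ : Dual (ZMod 2) V} [Fintype (LinearMap.ker φ)] {a : V}
    (ha : φ a = 1) {M : Type*} [AddCommMonoid M] (F : V → M) :
    ∑ x, F x = ∑ w : LinearMap.ker φ, F w + ∑ w : LinearMap.ker φ, F (w + a) := by
  classical
  have h := Fintype.sum_sum_type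
    (Sum.elim (fun w : LinearMap.ker φ => F w) (fun w : LinearMap.ker φ => F (w + a)))
  simp only [Sum.elim_inl, Sum.elim_inr] at h
  rw [← h]
  symm
  refine Fintype.sum_bijective (Sum.elim
    (fun w : LinearMap.ker φ => (w : V)) (fun w : LinearMap.ker φ => (w + a : V))) ⟨?_, ?_⟩ _ _ ?_
  · rintro (w | w) (w' | w') h
    · simpa using h
    · have := congrArg φ h
      simp [ha] at this
    · have := congrArg φ h
      simp [ha] at this
    · simpa using h
  · exact forall_of_cosets ha (fun w => ⟨.inl w, rfl⟩) (fun w => ⟨.inr w, rfl⟩)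
  · rintro (w | w) <;> rfl

theorem card_eq_two_mul_card_ker [Fintype V] {φ : Dual (ZMod 2) V} [Fintype (LinearMap.ker φ)]
    {a : V} (ha : φ a = 1) : Fintype.card V = 2 * Fintype.card (LinearMap.ker φ) := by
  have := sum_split ha (fun _ => 1)
  simp only [sum_const, card_univ, smul_eq_mul, mul_one] at this
  omega

theorem weight_split [Fintype V] {φ : Dual (ZMod 2) V} [Fintype (LinearMap.ker φ)]
    {a : V} (ha : φ a = 1) (f : V → ZMod 2) :
    weight f = weight (fun w : LinearMap.ker φ => f w) +
      weight (fun w : LinearMap.ker φ => f (w + a)) := sum_split ha _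

/-- Forms pulled back along `p` are independent of forms dual to vectors in the kernel of `p`. -/
theorem linearIndependent_sum_comp {W : Type*} [AddCommGroup W] [Module (ZMod 2) W]
    {ι κ : Type*} [Fintype ι] [DecidableEq ι] [Fintype κ] (p : V →ₗ[ZMod 2] W)
    (hp : Function.Surjective p) {z : κ → Dual (ZMod 2) W} (hz : LinearIndependent (ZMod 2) z)
    (θ : ι → Dual (ZMod 2) V) (t : ι → V) (ht : ∀ i, p (t i) = 0)
    (hθ : ∀ i j, θ i (t j) = if i = j then 1 else 0) :
    LinearIndependent (ZMod 2) (Sum.elim θ fun k => (z k).comp p) := by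
  rw [Fintype.linearIndependent_iff]
  intro g hg
  have happ : ∀ x, ∑ i, g (.inl i) * θ i x + ∑ k, g (.inr k) * z k (p x) = 0 := by
    intro x
    have := LinearMap.congr_fun hg x
    simpa using this
  have h1 : ∀ i, g (.inl i) = 0 := by
    intro i
    have := happ (t i)
    simpa [ht, hθ] using this
  have h2 : ∀ k, g (.inr k) = 0 := by
    refine Fintype.linearIndependent_iff.1 hz _ ?_
    ext w
    obtain ⟨x, rfl⟩ := hp w
    simpa [h1] using happ x
  rintro (i | k)
  · exact h1 i
  · exact h2 k

end Splitting

section Forms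

variable {V : Type*} [AddCommGroup V] [Module (ZMod 2) V]

/-- `f` is a product of `k` affine forms times `G` evaluated at further affine forms, all of them
independent. -/
def Rep (k : ℕ) {κ : Type} (G : (κ → ZMod 2) → ZMod 2) (f : V → ZMod 2) : Prop :=
  ∃ (z : Fin k ⊕ κ → Dual (ZMod 2) V) (c : Fin k ⊕ κ → ZMod 2), LinearIndependent (ZMod 2) z ∧
    ∀ x, f x = (∏ i, (c (.inl i) + z (.inl i) x)) * G fun j => c (.inr j) + z (.inr j) x

/-- The sum of two disjoint products of `μ` variables. -/
def twoProd (μ : ℕ) (w : Fin μ ⊕ Fin μ → ZMod 2) : ZMod 2 :=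
  ∏ i, w (.inl i) + ∏ i, w (.inr i)

/-- The hyperbolic quadratic form in `2μ` variables. -/
def hyperbolic (μ : ℕ) (w : Fin μ ⊕ Fin μ → ZMod 2) : ZMod 2 :=
  ∑ i, w (.inl i) * w (.inr i)

/-- The conclusion of the Kasami–Tokura classification. -/
def IsKT [Fintype V] (r : ℕ) (f : V → ZMod 2) : Prop :=
  (Rep r (fun _ : Empty → ZMod 2 => 1) f ∧ weight f * 2 ^ r = Fintype.card V) ∨
  (∃ k μ, 3 ≤ μ ∧ k + μ = r ∧ Rep k (twoProd μ) f ∧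
    weight f * 2 ^ r * 2 ^ μ + 2 * Fintype.card V = 2 * Fintype.card V * 2 ^ μ) ∨
  (∃ k μ, 2 ≤ μ ∧ k + 2 = r ∧ Rep k (hyperbolic μ) f ∧
    weight f * 2 ^ r * 2 ^ μ + 2 * Fintype.card V = 2 * Fintype.card V * 2 ^ μ)

theorem Rep.translate {k : ℕ} {κ : Type} {G : (κ → ZMod 2) → ZMod 2} {f : V → ZMod 2}
    (hf : Rep k G f) (b : V) : Rep k G fun x => f (x + b) := by
  obtain ⟨z, c, hz, h⟩ := hf
  refine ⟨z, fun i => c i + z i b, hz, fun x => ?_⟩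
  simp only [h, map_add]
  congr 2
  · funext i; ring
  · funext i; ring

theorem IsKT.translate [Fintype V] {r : ℕ} {f : V → ZMod 2} (hf : IsKT r f) (b : V) :
    IsKT r fun x => f (x + b) := by
  simp only [IsKT, weight_translate]
  rcases hf with ⟨h, hw⟩ | ⟨k, μ, h1, h2, h, hw⟩ | ⟨k, μ, h1, h2, h, hw⟩
  · exact .inl ⟨h.translate b, hw⟩
  · exact .inr (.inl ⟨k, μ, h1, h2, h.translate b, hw⟩)
  · exact .inr (.inr ⟨k, μ, h1, h2, h.translate b, hw⟩)

theorem isKT_translate_iff [Fintype V] {r : ℕ} {f : V → ZMod 2} (b : V) :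
    IsKT r (fun x => f (x + b)) ↔ IsKT r f := by
  refine ⟨fun h => ?_, fun h => h.translate b⟩
  simpa [add_assoc, add_self_module] using h.translate b

theorem Rep.mul_form {k : ℕ} {κ : Type} [Fintype κ] {G : (κ → ZMod 2) → ZMod 2}
    {φ : Dual (ZMod 2) V} {a : V} (ha : φ a = 1) {g : LinearMap.ker φ → ZMod 2} (hg : Rep k G g)
    {f : V → ZMod 2} (hf : ∀ x, f x = φ x * g (proj φ a ha x)) : Rep (k + 1) G f := by
  obtain ⟨z, c, hz, h⟩ := hg
  have hli := linearIndependent_sum_comp (proj φ a ha) (proj_surjective ha) hz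
    (fun _ : Unit => φ) (fun _ => a) (fun _ => proj_self ha) (by simp [ha])
  let e : Fin (k + 1) ⊕ κ → Unit ⊕ (Fin k ⊕ κ) :=
    Sum.elim (Fin.cons (.inl ()) fun i => .inr (.inl i)) fun j => .inr (.inr j)
  have he : Function.Injective e := by
    rintro (i | i) (j | j)
    · refine Fin.cases ?_ (fun i => ?_) i <;> refine Fin.cases ?_ (fun j => ?_) j <;> simp [e]
    · refine Fin.cases ?_ (fun i => ?_) i <;> simp [e]
    · refine Fin.cases ?_ (fun j => ?_) j <;> simp [e]
    · simp [e]
  refine ⟨_, Sum.elim (fun _ => 0) c ∘ e, hli.comp e he, fun x => ?_⟩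
  rw [hf, h, Fin.prod_univ_succ]
  simp [e, mul_assoc]

theorem IsKT.mul_form [Fintype V] {φ : Dual (ZMod 2) V} [Fintype (LinearMap.ker φ)] {a : V}
    (ha : φ a = 1) {r : ℕ} {g : LinearMap.ker φ → ZMod 2} (hg : IsKT r g)
    {f : V → ZMod 2} (hf : ∀ x, f x = φ x * g (proj φ a ha x)) : IsKT (r + 1) f := by
  have hw : weight f = weight g := by
    rw [weight_split ha]
    simp only [hf, proj_coe_add, apply_coe_ker, apply_coe_ker_add ha]
    simp [weight]
  have hc := card_eq_two_mul_card_ker (φ := φ) ha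
  rcases hg with ⟨h, hg⟩ | ⟨k, μ, h1, h2, h, hg⟩ | ⟨k, μ, h1, h2, h, hg⟩
  · refine .inl ⟨h.mul_form ha hf, ?_⟩
    rw [hw, hc, ← hg]; ring
  · refine .inr (.inl ⟨k + 1, μ, h1, by omega, h.mul_form ha hf, ?_⟩)
    rw [hw, hc]; linear_combination 2 * hg
  · refine .inr (.inr ⟨k + 1, μ, h1, by omega, h.mul_form ha hf, ?_⟩)
    rw [hw, hc]; linear_combination 2 * hg

end Forms

section Quadratic

theorem weight_eq_of_affine {V : Type*} [AddCommGroup V] [Module (ZMod 2) V] [Fintype V]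
    {φ : Dual (ZMod 2) V} (hφ : φ ≠ 0) (c : ZMod 2) :
    weight (fun x => c + φ x) * 2 = Fintype.card V := by
  have hli : LinearIndependent (ZMod 2) fun _ : Unit => φ := by
    rw [linearIndependent_unique_iff]; exact hφ
  simpa using card_linear_fiber hli fun _ => c

theorem weight_const_one {V : Type*} [Fintype V] : weight (fun _ : V => 1) = Fintype.card V := by
  simp [weight, ZMod.val_one]

theorem Rep.hyperbolic_succ {V W : Type*} [AddCommGroup V] [Module (ZMod 2) V]
    [AddCommGroup W] [Module (ZMod 2) W] {μ : ℕ} {g : W → ZMod 2} (hg : Rep 0 (hyperbolic μ) g)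
    (p : V →ₗ[ZMod 2] W) (hp : Function.Surjective p) {α β : Dual (ZMod 2) V} {a b : V}
    (ha : p a = 0) (hb : p b = 0) (hαa : α a = 0) (hαb : α b = 1) (hβa : β a = 1) (hβb : β b = 0)
    (s t : ZMod 2) {f : V → ZMod 2} (hf : ∀ x, f x = (s + α x) * (t + β x) + g (p x)) :
    Rep 0 (hyperbolic (μ + 1)) f := by
  obtain ⟨z, c, hz, h⟩ := hg
  have hli := linearIndependent_sum_comp p hp hz ![α, β] ![b, a]
    (by simp [Fin.forall_fin_two, ha, hb])
    (by simp [Fin.forall_fin_two, hαa, hαb, hβa, hβb])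
  let e : Fin 0 ⊕ (Fin (μ + 1) ⊕ Fin (μ + 1)) → Fin 2 ⊕ (Fin 0 ⊕ (Fin μ ⊕ Fin μ)) :=
    Sum.elim (fun i => i.elim0) (Sum.elim
      (Fin.cons (.inl 0) fun i => .inr (.inr (.inl i)))
      (Fin.cons (.inl 1) fun i => .inr (.inr (.inr i))))
  have he : Function.Injective e := by
    rintro (i | i | i) (j | j | j)
    all_goals first
      | exact i.elim0
      | exact j.elim0
      | (refine Fin.cases ?_ (fun i => ?_) i <;> refine Fin.cases ?_ (fun j => ?_) j <;> simp [e])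
  refine ⟨_, Sum.elim ![s, t] c ∘ e, hli.comp e he, fun x => ?_⟩
  rw [hf, h, hyperbolic, hyperbolic, Fin.sum_univ_succ]
  simp [e]

theorem exists_hyperbolic (n : ℕ) : ∀ (V : Type u) [AddCommGroup V] [Module (ZMod 2) V]
    [Fintype V], Fintype.card V = n → ∀ f : V → ZMod 2, DegreeLE 2 f →
    weight f * 2 < Fintype.card V →
    ∃ μ, Rep 0 (hyperbolic μ) f ∧
      weight f * 2 * 2 ^ μ + Fintype.card V = Fintype.card V * 2 ^ μ := by
  induction n using Nat.strong_induction_on with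
  | _ n ih =>
  intro V _ _ _ hn f hf hw
  by_cases hD : ∀ a b x, derivative b (derivative a f) x = 0
  · have h1 : DegreeLE 1 f := by
      intro a x y
      have h (x) : derivative a f x = derivative a f 0 := by
        have := hD a x 0
        rw [derivative, zero_add] at this
        linear_combination this - add_self_zmod (derivative a f 0)
      rw [h x, h y]
    obtain ⟨φ, hφ⟩ := h1.exists_affine
    have hφ0 : φ = 0 := by
      by_contra h
      have := weight_eq_of_affine h (f 0)
      rw [← funext hφ] at this
      omega
    subst hφ0
    have hf0 : f 0 = 0 := by
      refine (eq_zero_or_one _).resolve_right fun h => ?_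
      have h1 : f = fun _ => 1 := by funext x; rw [hφ, h]; simp
      rw [h1, weight_const_one] at hw
      omega
    have hf' : ∀ x, f x = 0 := fun x => by rw [hφ, hf0]; simp
    refine ⟨0, ⟨fun _ => 0, fun _ => 0, linearIndependent_empty_type, fun x => ?_⟩, ?_⟩
    · simp [hf', hyperbolic]
    · simp [weight_eq_zero.2 hf']
  · push Not at hD
    obtain ⟨a, b, x₀, hx₀⟩ := hD
    obtain ⟨α, hα⟩ := (hf a).exists_affine
    obtain ⟨β, hβ⟩ := (hf b).exists_affine
    set s := derivative a f 0
    set t := derivative b f 0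
    simp only [derivative] at hα hβ
    have hαb : α b = 1 := by
      refine (eq_zero_or_one _).resolve_left fun h => hx₀ ?_
      simp only [derivative]
      rw [hα, hα, map_add, h, add_zero, add_self_zmod]
    have hαa : α a = 0 := by
      have h1 := hα (x₀ + a)
      have h2 := hα x₀
      rw [add_assoc, add_self_module, add_zero, map_add] at h1
      linear_combination h2 - h1
    have hβb : β b = 0 := by
      have h1 := hβ (x₀ + b)
      have h2 := hβ x₀
      rw [add_assoc, add_self_module, add_zero, map_add] at h1
      linear_combination h2 - h1
    have hβa : β a = 1 := by
      have h1 := hβ (x₀ + a)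
      have h2 := hβ x₀
      have h3 := hα (x₀ + b)
      have h4 := hα x₀
      rw [add_right_comm, map_add] at h1
      rw [map_add, hαb] at h3
      linear_combination h3 + h2 - h1 - h4
        + add_self_zmod (f (x₀ + a)) - add_self_zmod (f (x₀ + b))
    let a' : LinearMap.ker α := ⟨a, hαa⟩
    let β' : Dual (ZMod 2) (LinearMap.ker α) := β.comp (LinearMap.ker α).subtype
    have ha' : β' a' = 1 := hβa
    let p : V →ₗ[ZMod 2] LinearMap.ker β' := (proj β' a' ha').comp (proj α b hαb)
    have hp : Function.Surjective p := (proj_surjective ha').comp (proj_surjective hαb)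
    have := Fintype.ofFinite (LinearMap.ker α)
    have := Fintype.ofFinite (LinearMap.ker β')
    let g : LinearMap.ker β' → ZMod 2 := fun w => f w + s * t
    have hp00 (w : LinearMap.ker β') : p (w : LinearMap.ker α) = w := by
      simp [p, proj_coe]
    have hp10 (w : LinearMap.ker β') : p ((w + a' : LinearMap.ker α) : V) = w := by
      simp only [p, LinearMap.comp_apply, proj_coe, proj_coe_add]
    have hp01 (w : LinearMap.ker β') : p ((w : LinearMap.ker α) + b) = w := by
      simp only [p, LinearMap.comp_apply, proj_coe, proj_coe_add]
    have hp11 (w : LinearMap.ker β') : p ((w + a' : LinearMap.ker α) + b) = w := by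
      simp only [p, LinearMap.comp_apply, proj_coe_add]
    have hα0 (w : LinearMap.ker β') : α (w : LinearMap.ker α) = 0 := apply_coe_ker _
    have hβ0 (w : LinearMap.ker β') : β (w : LinearMap.ker α) = 0 := apply_coe_ker w
    have hfa (x : V) : f (x + a) = s + α x + f x := by
      linear_combination hα x - add_self_zmod (f x)
    have hfb (x : V) : f (x + b) = t + β x + f x := by
      linear_combination hβ x - add_self_zmod (f x)
    have hfg : ∀ x, f x = (s + α x) * (t + β x) + g (p x) := by
      apply forall_of_cosets hαb (p := fun x => f x = (s + α x) * (t + β x) + g (p x))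
      · apply forall_of_cosets ha' (p := fun x => f x = (s + α x) * (t + β x) + g (p x))
        · intro w
          rw [hp00, hα0, hβ0]
          linear_combination -add_self_zmod (s * t)
        · intro w
          rw [hp10, Submodule.coe_add, hfa, map_add, map_add, hα0, hβ0, hαa, hβa]
          linear_combination -add_self_zmod (s * t)
      · apply forall_of_cosets ha'
          (p := fun x => f (x + b) = (s + α (x + b)) * (t + β (x + b)) + g (p (x + b)))
        · intro w
          rw [hp01, hfb, map_add, map_add, hα0, hβ0, hαb, hβb]
          linear_combination -add_self_zmod (s * t)
        · intro w
          rw [hp11, Submodule.coe_add, hfb, hfa]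
          simp only [map_add, hα0, hβ0, hαa, hβa, hαb, hβb, a']
          linear_combination -add_self_zmod (s * t)
    have hcard : Fintype.card V = 4 * Fintype.card (LinearMap.ker β') := by
      rw [card_eq_two_mul_card_ker hαb, card_eq_two_mul_card_ker ha']; ring
    have hcompl : weight (fun w => 1 + g w) + weight g = Fintype.card (LinearMap.ker β') := by
      rw [weight, weight, ← sum_add_distrib, ← card_univ, card_eq_sum_ones]
      refine Finset.sum_congr rfl fun w _ => ?_
      generalize g w = y
      revert y; decide
    have hweight : weight f = 2 * weight g + Fintype.card (LinearMap.ker β') := by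
      rw [weight_split hαb, weight_split ha', weight_split ha']
      have h00 (w : LinearMap.ker β') : f (w : LinearMap.ker α) = s * t + g w := by
        rw [hfg, hp00, hα0, hβ0, add_zero, add_zero]
      have h10 (w : LinearMap.ker β') : f (w + a' : LinearMap.ker α) = s * (t + 1) + g w := by
        rw [hfg, hp10, Submodule.coe_add, map_add, map_add, hα0, hβ0, hαa, hβa]
        simp only [add_zero, zero_add]
      have h01 (w : LinearMap.ker β') : f ((w : LinearMap.ker α) + b) = (s + 1) * t + g w := by
        rw [hfg, hp01, map_add, map_add, hα0, hβ0, hαb, hβb]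
        simp only [add_zero, zero_add]
      have h11 (w : LinearMap.ker β') :
          f ((w + a' : LinearMap.ker α) + b) = (s + 1) * (t + 1) + g w := by
        rw [hfg, hp11, Submodule.coe_add, map_add, map_add, map_add, map_add, hα0, hβ0, hαa, hβa,
          hαb, hβb]
        simp only [add_zero, zero_add]
      simp only [h00, h10, h01, h11]
      have hg : weight (fun w => g w) = weight g := rfl
      rcases eq_zero_or_one s with hs | hs <;> rcases eq_zero_or_one t with ht | ht <;>
        simp only [hs, ht, mul_zero, zero_add, mul_one, add_self_zmod] <;> omega
    have hg2 : DegreeLE 2 g := by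
      have h := hf.comp ((LinearMap.ker α).subtype.comp (LinearMap.ker β').subtype) 0
      simpa using h.add (degreeLE_const 2 (s * t))
    have hpos : 0 < Fintype.card (LinearMap.ker β') := Fintype.card_pos
    obtain ⟨μ, hrep, hμ⟩ := ih (Fintype.card (LinearMap.ker β')) (by omega) _ rfl g hg2 (by omega)
    refine ⟨μ + 1, hrep.hyperbolic_succ p hp ?_ ?_ hαa hαb hβa hβb s t hfg, ?_⟩
    · have := hp10 0
      simpa [a'] using this
    · have := hp01 0
      simpa using this
    · rw [hweight, hcard]
      linear_combination 4 * hμ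

end Quadratic

section Vanishing

variable {V : Type u} [AddCommGroup V] [Module (ZMod 2) V] [Fintype V]

/-- The classification holds for all functions on spaces smaller than `V`. -/
def ClassifiedBelow (V : Type u) [Fintype V] : Prop :=
  ∀ (W : Type u) [AddCommGroup W] [Module (ZMod 2) W] [Fintype W],
    Fintype.card W < Fintype.card V → ∀ (r : ℕ) (g : W → ZMod 2), DegreeLE r g → 0 < weight g →
      weight g * 2 ^ r < 2 * Fintype.card W → IsKT r g

theorem isKT_of_vanishing (hV : ClassifiedBelow V) {r : ℕ} {f : V → ZMod 2}
    (hf : DegreeLE (r + 1) f) (hf0 : 0 < weight f)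
    (hw : weight f * 2 ^ (r + 1) < 2 * Fintype.card V) {φ : Dual (ZMod 2) V} (hφ : φ ≠ 0)
    (c : ZMod 2) (h : ∀ x, φ x = c → f x = 0) : IsKT (r + 1) f := by
  obtain ⟨a, ha⟩ := exists_apply_eq_one hφ
  have := Fintype.ofFinite (LinearMap.ker φ)
  rw [← isKT_translate_iff (c • a)]
  rw [← weight_translate f (c • a)] at hf0 hw
  have hzero (w : LinearMap.ker φ) : f (w + c • a) = 0 :=
    h _ (by rw [map_add, apply_coe_ker, map_smul, ha]; simp)
  have hcard := card_eq_two_mul_card_ker ha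
  have hwt := weight_split ha fun x => f (x + c • a)
  rw [weight_eq_zero.2 hzero, zero_add] at hwt
  refine IsKT.mul_form ha (g := fun w => f (w + a + c • a)) (hV _ ?_ r _ ?_ ?_ ?_)
    (forall_of_cosets ha ?_ ?_)
  · have : 0 < Fintype.card (LinearMap.ker φ) := Fintype.card_pos
    omega
  · have := (hf a).comp (LinearMap.ker φ).subtype (c • a)
    convert this using 1
    funext w
    simp only [derivative, Submodule.subtype_apply, hzero, add_zero]
    rw [add_right_comm]
  · rwa [← hwt]
  · rw [← hwt]
    rw [pow_succ, ← mul_assoc] at hw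
    omega
  · intro w
    rw [hzero, apply_coe_ker, zero_mul]
  · intro w
    rw [apply_coe_ker_add ha, proj_coe_add, one_mul]

theorem isKT_zero {f : V → ZMod 2} (hf : DegreeLE 0 f) (hf0 : 0 < weight f) : IsKT 0 f := by
  have h1 : f = fun _ => 1 := by
    funext x
    refine (eq_zero_or_one _).resolve_left fun h => ?_
    have := weight_eq_zero.2 fun y => (hf y x).trans h
    omega
  refine .inl ⟨⟨fun _ => 0, fun _ => 0, linearIndependent_empty_type, fun x => ?_⟩, ?_⟩
  · simp [h1]
  · simp [h1, weight_const_one]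

theorem isKT_one (hV : ClassifiedBelow V) {f : V → ZMod 2} (hf : DegreeLE 1 f) (hf0 : 0 < weight f)
    (hw : weight f * 2 ^ 1 < 2 * Fintype.card V) : IsKT 1 f := by
  obtain ⟨φ, hφ⟩ := hf.exists_affine
  have hne : φ ≠ 0 := by
    rintro rfl
    rcases eq_zero_or_one (f 0) with h | h
    · have := weight_eq_zero.2 (show ∀ x, f x = 0 from fun x => by rw [hφ, h]; simp)
      omega
    · have h1 : f = fun _ => 1 := by funext x; rw [hφ, h]; simp
      rw [h1, weight_const_one] at hw
      omega
  refine isKT_of_vanishing hV hf hf0 hw hne (f 0) fun x hx => ?_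
  rw [hφ, hx, add_self_zmod]

theorem isKT_two (hV : ClassifiedBelow V) {f : V → ZMod 2} (hf : DegreeLE 2 f) (hf0 : 0 < weight f)
    (hw : weight f * 2 ^ 2 < 2 * Fintype.card V) : IsKT 2 f := by
  obtain ⟨μ, hrep, hμ⟩ := exists_hyperbolic _ V rfl f hf (by omega)
  rcases lt_or_ge μ 2 with h | h
  · have hμ' : μ = 0 ∨ μ = 1 := by omega
    rcases hμ' with rfl | rfl
    · simp at hμ
      omega
    · obtain ⟨z, c, hz, h⟩ := hrep
      refine isKT_of_vanishing hV hf hf0 hw (hz.ne_zero (.inr (.inl 0))) (c (.inr (.inl 0)))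
        fun x hx => ?_
      simp [h, hyperbolic, hx, add_self_zmod]
  · exact .inr (.inr ⟨0, μ, h, rfl, hrep, by linear_combination 2 * hμ⟩)

end Vanishing

section HyperplaneWeight

variable {V : Type u} [AddCommGroup V] [Module (ZMod 2) V] [Fintype V]

/-- `f` does not vanish identically on any affine hyperplane. -/
def Primitive (f : V → ZMod 2) : Prop :=
  ∀ φ : Dual (ZMod 2) V, φ ≠ 0 → ∀ c, ∃ x, φ x = c ∧ f x = 1

/-- The weight of `f` on the affine hyperplane `φ = c`. -/
def hyperplaneWeight (f : V → ZMod 2) (φ : Dual (ZMod 2) V) (c : ZMod 2) : ℕ :=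
  ∑ x, (f x).val * (φ x + c + 1).val

theorem hyperplaneWeight_zero_add_one (f : V → ZMod 2) (φ : Dual (ZMod 2) V) :
    hyperplaneWeight f φ 0 + hyperplaneWeight f φ 1 = weight f := by
  simp only [hyperplaneWeight, weight, ← sum_add_distrib]
  refine sum_congr rfl fun x _ => ?_
  generalize f x = s; generalize φ x = t
  revert s t; decide

theorem hyperplaneWeight_translate (f : V → ZMod 2) (φ : Dual (ZMod 2) V) (b : V) (c : ZMod 2) :
    hyperplaneWeight (fun x => f (x + b)) φ c = hyperplaneWeight f φ (c + φ b) := by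
  refine Fintype.sum_equiv (Equiv.addRight b) _ _ fun x => ?_
  rw [Equiv.coe_addRight, map_add]
  congr 2
  linear_combination -add_self_zmod (φ b)

theorem hyperplaneWeight_eq_weight_ker (f : V → ZMod 2) {φ : Dual (ZMod 2) V}
    [Fintype (LinearMap.ker φ)] {a : V} (ha : φ a = 1) :
    hyperplaneWeight f φ 0 = weight fun w : LinearMap.ker φ => f w := by
  rw [hyperplaneWeight, sum_split ha]
  simp only [apply_coe_ker, apply_coe_ker_add ha, weight]
  simp [ZMod.val_one, add_self_zmod]

/-- Inclusion-exclusion over the three hyperplanes through a flat of codimension two. -/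
theorem three_mul_weight_ker_le {f : V → ZMod 2} {φ : Dual (ZMod 2) V}
    [Fintype (LinearMap.ker φ)] {a : V} (ha : φ a = 1)
    (hmin : ∀ ψ : Dual (ZMod 2) V, ψ ≠ 0 → ∀ c,
      weight (fun w : LinearMap.ker φ => f w) ≤ hyperplaneWeight f ψ c)
    {z : Dual (ZMod 2) (LinearMap.ker φ)} (hz : z ≠ 0) (c : ZMod 2) :
    3 * weight (fun w : LinearMap.ker φ => f w) ≤
      weight f + 2 * hyperplaneWeight (fun w : LinearMap.ker φ => f w) z c := by
  obtain ⟨w, hw⟩ := exists_apply_eq_one hz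
  let ζ : Dual (ZMod 2) V := z.comp (proj φ a ha)
  have hζw : ζ w = 1 := by simp [ζ, proj_coe, hw]
  have h1 : ζ ≠ 0 := by rintro h; simp [h] at hζw
  have h2 : φ + ζ ≠ 0 := by
    intro h
    have := LinearMap.congr_fun h w
    simp [hζw] at this
  have key : weight f + 2 * ∑ x, (f x).val * ((φ x + 1).val * (ζ x + c + 1).val) =
      hyperplaneWeight f φ 0 + hyperplaneWeight f ζ c + hyperplaneWeight f (φ + ζ) c := by
    simp only [hyperplaneWeight, weight, mul_sum, ← sum_add_distrib, LinearMap.add_apply]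
    refine sum_congr rfl fun x _ => ?_
    generalize f x = p; generalize φ x = q; generalize ζ x = r
    revert p q r c; decide
  have h00 : ∑ x, (f x).val * ((φ x + 1).val * (ζ x + c + 1).val) =
      hyperplaneWeight (fun w : LinearMap.ker φ => f w) z c := by
    rw [sum_split ha]
    simp only [apply_coe_ker, apply_coe_ker_add ha, ζ, LinearMap.comp_apply, proj_coe]
    simp [ZMod.val_one, add_self_zmod, hyperplaneWeight]
  have h3 := hmin φ (by rintro rfl; simp at ha) 0
  have h4 := hmin ζ h1 c
  have h5 := hmin _ h2 c
  omega

theorem Rep.hyperplaneWeight_eq_zero {k : ℕ} {κ : Type} {G : (κ → ZMod 2) → ZMod 2}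
    {f : V → ZMod 2} (hf : Rep (k + 1) G f) :
    ∃ z : Dual (ZMod 2) V, z ≠ 0 ∧ ∃ c, (∀ x, z x = c → f x = 0) ∧ hyperplaneWeight f z c = 0 := by
  obtain ⟨z, c, hz, h⟩ := hf
  have h0 : ∀ x, z (.inl 0) x = c (.inl 0) → f x = 0 := fun x hx => by
    rw [h, Fin.prod_univ_succ, hx, add_self_zmod, zero_mul, zero_mul]
  refine ⟨z (.inl 0), hz.ne_zero _, c (.inl 0), h0, Finset.sum_eq_zero fun x _ => ?_⟩
  rcases eq_zero_or_one (z (.inl 0) x + c (.inl 0)) with hx | hx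
  · rw [h0 x (by linear_combination hx - add_self_zmod (c (.inl 0))), ZMod.val_zero, zero_mul]
  · rw [hx, add_self_zmod, ZMod.val_zero, mul_zero]

theorem three_mul_le_of_weight_eq {A C M : ℕ} (h : A * M + 2 * C = 2 * C * M) (hM : 4 ≤ M) :
    3 * C ≤ 2 * A := by
  by_contra! hlt
  have : (2 * A) * M + M ≤ 3 * C * M := by nlinarith
  nlinarith

theorem seven_mul_le_of_weight_eq {A C M : ℕ} (h : A * M + 2 * C = 2 * C * M) (hM : 8 ≤ M) :
    7 * C ≤ 4 * A := by
  by_contra! hlt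
  have : (4 * A) * M + M ≤ 7 * C * M := by nlinarith
  nlinarith

/-- On a hyperplane of minimal weight, `f` is the indicator function of a flat. -/
theorem rep_of_hyperplaneWeight_min (hV : ClassifiedBelow V) {r : ℕ} (hr : 3 ≤ r)
    {f : V → ZMod 2} (hf : DegreeLE r f) (hw : weight f * 2 ^ r < 2 * Fintype.card V)
    (hP : Primitive f) {φ : Dual (ZMod 2) V} [Fintype (LinearMap.ker φ)] {a : V} (ha : φ a = 1)
    (hmin : ∀ ψ : Dual (ZMod 2) V, ψ ≠ 0 → ∀ c,
      weight (fun w : LinearMap.ker φ => f w) ≤ hyperplaneWeight f ψ c) :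
    Rep r (fun _ : Empty → ZMod 2 => 1) (fun w : LinearMap.ker φ => f w) ∧
      weight (fun w : LinearMap.ker φ => f w) * 2 ^ r = Fintype.card (LinearMap.ker φ) := by
  have hφ : φ ≠ 0 := by rintro rfl; simp at ha
  have hcard := card_eq_two_mul_card_ker ha
  have hpos : 0 < Fintype.card (LinearMap.ker φ) := Fintype.card_pos
  have hsum := hyperplaneWeight_zero_add_one f φ
  have h1 := hmin φ hφ 1
  rw [hyperplaneWeight_eq_weight_ker f ha] at hsum
  have hle := fun {z} hz c => three_mul_weight_ker_le ha hmin (z := z) hz c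
  set f₀ : LinearMap.ker φ → ZMod 2 := fun w => f w with hf₀
  have hne : 0 < weight f₀ := by
    rw [Nat.pos_iff_ne_zero, Ne, weight_eq_zero]
    obtain ⟨x, hx, hfx⟩ := hP φ hφ 0
    intro h
    have := h ⟨x, hx⟩
    simp [hf₀, hfx] at this
  have hlt : weight f₀ * 2 ^ r < 2 * Fintype.card (LinearMap.ker φ) := by nlinarith
  have hkt : IsKT r f₀ := by
    refine hV _ (by omega) r f₀ ?_ hne hlt
    have := hf.comp (LinearMap.ker φ).subtype 0
    simpa using this
  have hcommon : ∀ {k : ℕ} {κ : Type} {G : (κ → ZMod 2) → ZMod 2}, Rep (k + 1) G f₀ → ∀ μ, 2 ≤ μ →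
      weight f₀ * 2 ^ r * 2 ^ μ + 2 * Fintype.card (LinearMap.ker φ) =
        2 * Fintype.card (LinearMap.ker φ) * 2 ^ μ → False := by
    intro k κ G hrep μ hμ hwt
    obtain ⟨z, hz, c, -, h0⟩ := hrep.hyperplaneWeight_eq_zero
    have h3 := hle hz c
    have h4 := three_mul_le_of_weight_eq hwt
      (by calc 4 = 2 ^ 2 := rfl
            _ ≤ 2 ^ μ := Nat.pow_le_pow_right (by norm_num) hμ)
    rw [h0] at h3
    have h5 := Nat.mul_le_mul_right (2 ^ r) h3
    rw [mul_zero, add_zero, mul_assoc] at h5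
    omega
  rcases hkt with h | ⟨k, μ, h3, hk, hrep, hwt⟩ | ⟨k, μ, h2, hk, hrep, hwt⟩
  · exact h
  · exfalso
    rcases k with _ | k
    · rw [zero_add] at hk
      subst hk
      obtain ⟨z, c, hz, h⟩ := hrep
      let i₀ : Fin 0 ⊕ (Fin μ ⊕ Fin μ) := .inr (.inl ⟨0, by omega⟩)
      let e : Option (Fin μ) → Fin 0 ⊕ (Fin μ ⊕ Fin μ) :=
        fun o => o.elim i₀ fun i => .inr (.inr i)
      have he : Function.Injective e := by
        rintro (_ | i) (_ | j) <;> simp [e, i₀]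
      have hc := card_linear_fiber (hz.comp e he)
        (fun o => o.elim (c i₀ + 1) fun i => c (.inr (.inr i)))
      have h4 : hyperplaneWeight f₀ (z i₀) (c i₀) ≤ weight fun w => ∏ o : Option (Fin μ),
          ((o.elim (c i₀ + 1) fun i => c (.inr (.inr i))) + (z ∘ e) o w) := by
        refine Finset.sum_le_sum fun w _ => ?_
        dsimp only
        rw [h, Fintype.prod_option]
        simp only [Option.elim_none, Option.elim_some, Function.comp_apply, e, twoProd,
          univ_eq_empty, prod_empty, one_mul]
        have h5 : c i₀ + z i₀ w = 0 → ∏ i, (c (.inr (.inl i)) + z (.inr (.inl i)) w) = 0 :=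
          fun h => prod_eq_zero (mem_univ ⟨0, by omega⟩) h
        revert h5
        generalize ∏ i, (c (.inr (.inl i)) + z (.inr (.inl i)) w) = p
        generalize ∏ i, (c (.inr (.inr i)) + z (.inr (.inr i)) w) = q
        generalize c i₀ = s
        generalize z i₀ w = t
        revert p q s t
        decide
      have h5 := hle (hz.ne_zero i₀) (c i₀)
      have h6 := seven_mul_le_of_weight_eq hwt
        (by calc 8 = 2 ^ 3 := rfl
              _ ≤ 2 ^ μ := Nat.pow_le_pow_right (by norm_num) h3)
      rw [Fintype.card_option, Fintype.card_fin, pow_succ, ← mul_assoc] at hc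
      have h7 := Nat.mul_le_mul_right (2 ^ μ) h4
      have h8 := Nat.mul_le_mul_right (2 ^ μ) h5
      rw [add_mul, mul_assoc, mul_assoc] at h8
      omega
    · exact hcommon hrep μ (by omega) hwt
  · exfalso
    obtain ⟨k, rfl⟩ : ∃ l, k = l + 1 := ⟨k - 1, by omega⟩
    exact hcommon hrep μ h2 hwt

end HyperplaneWeight

section TwoFlats

variable {V : Type u} [AddCommGroup V] [Module (ZMod 2) V] [Fintype V]

theorem prod_eq_one_iff {ι : Type*} [Fintype ι] {y : ι → ZMod 2} : ∏ i, y i = 1 ↔ ∀ i, y i = 1 := by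
  refine ⟨fun h i => (eq_zero_or_one _).resolve_left fun hi => ?_,
    fun h => prod_eq_one fun i _ => h i⟩
  rw [prod_eq_zero (mem_univ i) hi] at h
  exact zero_ne_one h

/-- A primitive function of small weight that is a sum of two flats falls under the second case of
the classification. -/
theorem isKT_of_add_flats {r : ℕ} (hr : 3 ≤ r) {f : V → ZMod 2}
    (hw : weight f * 2 ^ r < 2 * Fintype.card V) (hP : Primitive f)
    {u v : Fin r → Dual (ZMod 2) V} (hu : LinearIndependent (ZMod 2) u)
    (hv : LinearIndependent (ZMod 2) v) (c d : Fin r → ZMod 2)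
    (hf : ∀ x, f x = ∏ i, (c i + u i x) + ∏ i, (d i + v i x)) : IsKT r f := by
  have hadd := weight_add (fun x => ∏ i, (c i + u i x)) (fun x => ∏ i, (d i + v i x))
  rw [← funext hf] at hadd
  have hwu := card_linear_fiber hu c
  have hwv := card_linear_fiber hv d
  rw [Fintype.card_fin] at hwu hwv
  obtain ⟨p, hup, hvp⟩ : ∃ p, (∀ i, c i + u i p = 1) ∧ ∀ i, d i + v i p = 1 := by
    by_contra! hmeet
    have h0 : weight (fun x => (∏ i, (c i + u i x)) * ∏ i, (d i + v i x)) = 0 := by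
      rw [weight_eq_zero]
      intro x
      rw [mul_eq_zero]
      by_contra! hx
      have h1 := prod_eq_one_iff.1 ((eq_zero_or_one _).resolve_left hx.1)
      obtain ⟨i, hi⟩ := hmeet x h1
      exact hi (prod_eq_one_iff.1 ((eq_zero_or_one _).resolve_left hx.2) i)
    rw [h0, mul_zero, add_zero] at hadd
    rw [hadd, add_mul] at hw
    omega
  have hli : LinearIndependent (ZMod 2) (Sum.elim u v) := by
    rw [Fintype.linearIndependent_iff]
    intro g hg
    rw [Fintype.sum_sum_type] at hg
    simp only [Sum.elim_inl, Sum.elim_inr] at hg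
    have hℓ : ∑ i, g (.inl i) • u i = 0 := by
      by_contra hne
      obtain ⟨x, hx, hfx⟩ := hP _ hne ((∑ i, g (.inl i) • u i) p + 1)
      have hor : (∏ i, (c i + u i x)) = 1 ∨ (∏ i, (d i + v i x)) = 1 := by
        rw [hf] at hfx
        revert hfx
        generalize ∏ i, (c i + u i x) = s
        generalize ∏ i, (d i + v i x) = t
        revert s t
        decide
      have hpx : (∑ i, g (.inl i) • u i) x = (∑ i, g (.inl i) • u i) p := by
        rcases hor with h | h
        · rw [prod_eq_one_iff] at h
          simp only [LinearMap.sum_apply, LinearMap.smul_apply]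
          refine sum_congr rfl fun i _ => ?_
          rw [show u i x = u i p by linear_combination h i - hup i]
        · rw [prod_eq_one_iff] at h
          rw [eq_neg_of_add_eq_zero_left hg]
          simp only [LinearMap.neg_apply, LinearMap.sum_apply, LinearMap.smul_apply]
          congr 1
          refine sum_congr rfl fun i _ => ?_
          rw [show v i x = v i p by linear_combination h i - hvp i]
      rw [hpx] at hx
      simp at hx
    rw [hℓ, zero_add] at hg
    rintro (i | i)
    · exact Fintype.linearIndependent_iff.1 hu _ hℓ i
    · exact Fintype.linearIndependent_iff.1 hv _ hg i
  have hwuv := card_linear_fiber hli (Sum.elim c d)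
  simp only [Fintype.prod_sum_type, Sum.elim_inl, Sum.elim_inr, Fintype.card_sum,
    Fintype.card_fin] at hwuv
  refine .inr (.inl ⟨0, r, hr, zero_add r, ⟨Sum.elim (fun i => i.elim0) (Sum.elim u v),
    Sum.elim (fun i => i.elim0) (Sum.elim c d), ?_, fun x => ?_⟩, ?_⟩)
  · have he : Function.Injective
        (Sum.elim (fun i : Fin 0 => i.elim0) id : Fin 0 ⊕ (Fin r ⊕ Fin r) → Fin r ⊕ Fin r) := by
      rintro (i | i) (j | j)
      · exact i.elim0
      · exact i.elim0
      · exact j.elim0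
      · simp
    convert hli.comp _ he using 1
    funext i
    rcases i with i | i
    · exact i.elim0
    · rfl
  · rw [hf]
    simp [twoProd]
  · rw [pow_add] at hwuv
    zify at *
    linear_combination 2 ^ r * 2 ^ r * hadd + 2 ^ r * hwu + 2 ^ r * hwv - 2 * hwuv

end TwoFlats

section FlatSums

variable {W : Type*} [AddCommGroup W] [Module (ZMod 2) W] [Fintype W]

/-- The support of `f` is closed under sums of three points. -/
def IsFlat (f : W → ZMod 2) : Prop :=
  ∀ p q, f p = 1 → f q = 1 → ∀ w, f (w + (p + q)) = f w

theorem isFlat_prod {ι : Type*} [Fintype ι] (z : ι → Dual (ZMod 2) W) (c : ι → ZMod 2) :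
    IsFlat fun w => ∏ i, (c i + z i w) := by
  intro p q hp hq w
  rw [prod_eq_one_iff] at hp hq
  refine prod_congr rfl fun i _ => ?_
  rw [map_add, map_add]
  linear_combination hp i + hq i - add_self_zmod (c i) + add_self_zmod 1

/-- An affine function vanishing at some point of a flat vanishes on at least half of it. -/
theorem weight_le_two_mul_hyperplaneWeight {f : W → ZMod 2} (hf : IsFlat f) {p : W} (hp : f p = 1)
    (z : Dual (ZMod 2) W) : weight f ≤ 2 * hyperplaneWeight f z (z p) := by
  have hsum : hyperplaneWeight f z (z p) + hyperplaneWeight f z (z p + 1) = weight f := by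
    rw [← hyperplaneWeight_zero_add_one f z]
    rcases eq_zero_or_one (z p) with h | h <;> rw [h]
    · rw [zero_add]
    · rw [add_self_zmod, add_comm]
  by_cases hq : ∃ q, f q = 1 ∧ z q = z p + 1
  · obtain ⟨q, hq, hzq⟩ := hq
    have h := hyperplaneWeight_translate f z (p + q) (z p)
    simp only [hf p q hp hq, map_add, hzq] at h
    rw [show z p + (z p + (z p + 1)) = z p + 1 by linear_combination add_self_zmod (z p)] at h
    rw [h] at hsum ⊢
    omega
  · push Not at hq
    have : hyperplaneWeight f z (z p + 1) = 0 := by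
      refine sum_eq_zero fun x _ => ?_
      have := hq x
      revert this
      generalize f x = s; generalize z x = t; generalize z p = t'
      revert s t t'; decide
    omega

/-- The nontrivial character of `ZMod 2`. -/
def chi (t : ZMod 2) : ℤ := 1 - 2 * t.val

theorem chi_add_one (t : ZMod 2) : chi (t + 1) = -chi t := by
  revert t; decide

theorem chi_mul_cast (s t : ZMod 2) : ((chi s * chi t : ℤ) : ZMod 2) = 1 := by
  revert s t; decide

/-- The Walsh expansion of the hyperbolic quadric in four variables. -/
theorem four_mul_chi (x y s t : ZMod 2) :
    4 * chi (x * y + s * t) = ∑ L : ZMod 2 × ZMod 2 × ZMod 2 × ZMod 2,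
      chi (L.1 * L.2.1 + L.2.2.1 * L.2.2.2) *
        chi (L.1 * x + L.2.1 * y + L.2.2.1 * s + L.2.2.2 * t) := by
  revert x y s t; decide

/-- A function of the form `y₁ y₂ + y₃ y₄` with affine `yᵢ` cannot vanish on at least a third
but less than half of a flat. -/
theorem not_quadric_vanishing_between {f : W → ZMod 2} (hf : IsFlat f) {p : W} (hp : f p = 1)
    (z₁ z₂ z₃ z₄ : Dual (ZMod 2) W) (c₁ c₂ c₃ c₄ : ZMod 2) {n : ℕ}
    (hn : n = ∑ w, (f w).val *
      ((c₁ + z₁ w) * (c₂ + z₂ w) + (c₃ + z₃ w) * (c₄ + z₄ w) + 1).val)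
    (h2 : 2 * n < weight f) (h3 : weight f ≤ 3 * n) : False := by
  classical
  let ℓ : ZMod 2 × ZMod 2 × ZMod 2 × ZMod 2 → W → ZMod 2 := fun L w =>
    L.1 * (c₁ + z₁ w) + L.2.1 * (c₂ + z₂ w) + L.2.2.1 * (c₃ + z₃ w) + L.2.2.2 * (c₄ + z₄ w)
  let q : ZMod 2 × ZMod 2 × ZMod 2 × ZMod 2 → ZMod 2 := fun L => L.1 * L.2.1 + L.2.2.1 * L.2.2.2
  let T : ZMod 2 × ZMod 2 × ZMod 2 × ZMod 2 → Prop := fun L => ∀ x, f x = 1 → ℓ L x = ℓ L p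
  have hE (L) : ∑ w, ((f w).val : ℤ) * chi (ℓ L w) =
      weight f * if T L then chi (ℓ L p) else 0 := by
    split_ifs with h
    · rw [weight, Nat.cast_sum, sum_mul]
      refine sum_congr rfl fun w _ => ?_
      rcases eq_zero_or_one (f w) with hw | hw
      · simp [hw]
      · rw [h w hw]
    · simp only [T] at h
      push Not at h
      obtain ⟨x, hx, hne⟩ := h
      have hne' : ℓ L p + ℓ L x = 1 := by
        revert hne
        generalize ℓ L x = s; generalize ℓ L p = t
        revert s t; decide
      have hinv : ∑ w, ((f w).val : ℤ) * chi (ℓ L w) =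
          ∑ w, -(((f w).val : ℤ) * chi (ℓ L w)) := by
        refine Fintype.sum_equiv (Equiv.addRight (p + x)) _ _ fun w => ?_
        rw [Equiv.coe_addRight, hf p x hp hx,
          show ℓ L (w + (p + x)) = ℓ L w + 1 by
            rw [← hne']
            simp only [ℓ, map_add]
            linear_combination -(L.1 * add_self_zmod c₁) - L.2.1 * add_self_zmod c₂
              - L.2.2.1 * add_self_zmod c₃ - L.2.2.2 * add_self_zmod c₄,
          chi_add_one]
        ring
      rw [sum_neg_distrib] at hinv
      rw [mul_zero]
      omega
  let K : ℤ := ∑ L, chi (q L) * if T L then chi (ℓ L p) else 0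
  have hS : 4 * (2 * (n : ℤ) - weight f) = weight f * K := by
    have h1 : 2 * (n : ℤ) - weight f = ∑ w, ((f w).val : ℤ) *
        chi ((c₁ + z₁ w) * (c₂ + z₂ w) + (c₃ + z₃ w) * (c₄ + z₄ w)) := by
      rw [hn, weight, Nat.cast_sum, Nat.cast_sum, mul_sum, ← sum_sub_distrib]
      refine sum_congr rfl fun w _ => ?_
      generalize f w = s
      generalize (c₁ + z₁ w) * (c₂ + z₂ w) + (c₃ + z₃ w) * (c₄ + z₄ w) = t
      revert s t; decide
    have h4 (w) : 4 * (((f w).val : ℤ) *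
        chi ((c₁ + z₁ w) * (c₂ + z₂ w) + (c₃ + z₃ w) * (c₄ + z₄ w))) =
        ∑ L, chi (q L) * (((f w).val : ℤ) * chi (ℓ L w)) := by
      rw [mul_left_comm, four_mul_chi, mul_sum]
      exact sum_congr rfl fun L _ => by simp only [q, ℓ]; ring
    rw [h1, mul_sum, sum_congr rfl fun w _ => h4 w, sum_comm, mul_sum]
    refine sum_congr rfl fun L _ => ?_
    rw [← mul_sum, hE]
    ring
  have hK : K = 1 ∨ Even K := by
    by_cases hL : ∃ L, L ≠ 0 ∧ T L
    · right
      obtain ⟨L₀, hL₀, hT₀⟩ := hL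
      have hadd (L) : L + L₀ + L₀ = L := by
        rw [add_assoc, add_self_module, add_zero]
      have hℓ (L x) : ℓ (L + L₀) x = ℓ L x + ℓ L₀ x := by
        simp only [ℓ, Prod.fst_add, Prod.snd_add]; ring
      have hT (L) : T L → T (L + L₀) := fun h x hx => by rw [hℓ, hℓ, h x hx, hT₀ x hx]
      rw [← ZMod.intCast_eq_zero_iff_even]
      have : (K : ZMod 2) = ∑ L, if T L then 1 else 0 := by
        rw [Int.cast_sum]
        refine sum_congr rfl fun L _ => ?_
        split_ifs
        · exact chi_mul_cast _ _
        · simp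
      rw [this]
      refine sum_involution (fun L _ => L + L₀) (fun L _ => ?_) (fun L _ _ h => hL₀ ?_)
        (fun _ _ => mem_univ _) fun L _ => hadd L
      · have hiff : T (L + L₀) ↔ T L := ⟨fun h => by simpa only [hadd] using hT _ h, hT L⟩
        simp only [hiff, add_self_zmod]
      · simpa using h
    · left
      push Not at hL
      rw [show K = ∑ L, chi (q L) * if T L then chi (ℓ L p) else 0 from rfl, sum_eq_single 0]
      · have hT0 : T 0 := fun x _ => by simp [ℓ]
        rw [if_pos hT0]
        simp [q, ℓ, chi]
      · intro L _ hne
        rw [if_neg (hL L hne), mul_zero]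
      · exact fun h => absurd (mem_univ _) h
  have hb : (0 : ℤ) < weight f := by omega
  have h2' : 2 * (n : ℤ) < weight f := by exact_mod_cast h2
  have h3' : (weight f : ℤ) ≤ 3 * n := by exact_mod_cast h3
  have hK1 : K < 0 := by
    by_contra! h
    nlinarith
  have hK2 : -2 < K := by
    by_contra! h
    nlinarith
  obtain hK | hK := hK
  · omega
  · obtain ⟨k, hk⟩ := hK
    omega

end FlatSums

section Primitive

variable {V : Type u} [AddCommGroup V] [Module (ZMod 2) V] [Fintype V]

theorem Primitive.exists_ne_zero {f : V → ZMod 2} (hP : Primitive f) {φ : Dual (ZMod 2) V} {a : V}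
    (ha : φ a = 1) {z : Dual (ZMod 2) (LinearMap.ker φ)} (hz : z ≠ 0) (c : ZMod 2) :
    ∃ w : LinearMap.ker φ, z w = c ∧ (f w ≠ 0 ∨ f (w + a) ≠ 0) := by
  by_contra! h
  obtain ⟨w, hw⟩ := exists_apply_eq_one hz
  obtain ⟨x, hx, hfx⟩ := hP (z.comp (proj φ a ha))
    (fun h => by simpa [proj_coe, hw] using LinearMap.congr_fun h (w : V)) c
  revert hx hfx
  refine forall_of_cosets ha (p := fun x => z.comp (proj φ a ha) x = c → f x = 1 → False) ?_ ?_ x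
  · intro w hw hf
    rw [LinearMap.comp_apply, proj_coe] at hw
    rw [(h w hw).1] at hf
    exact zero_ne_one hf
  · intro w hw hf
    rw [LinearMap.comp_apply, proj_coe_add] at hw
    rw [(h w hw).2] at hf
    exact zero_ne_one hf

/-- Summing the overlap of `f` on `ker φ` and its translates over all translations. -/
theorem sum_overlap {f : V → ZMod 2} {φ : Dual (ZMod 2) V} [Fintype (LinearMap.ker φ)] {a : V}
    (ha : φ a = 1) :
    ∑ h : LinearMap.ker φ, weight (fun w : LinearMap.ker φ => f w * f (w + (a + h))) +
      weight (fun w : LinearMap.ker φ => f w) * weight (fun w : LinearMap.ker φ => f w) =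
      weight (fun w : LinearMap.ker φ => f w) * weight f := by
  rw [weight_split ha f, mul_add, add_comm]
  congr 1
  simp only [weight]
  rw [sum_comm, sum_mul_sum]
  refine sum_congr rfl fun w _ => ?_
  refine Fintype.sum_equiv (Equiv.addLeft w) _ _ fun h => ?_
  rw [Equiv.coe_addLeft, Submodule.coe_add, show (w : V) + (a + h) = w + h + a by abel]
  generalize f w = s
  generalize f _ = t
  revert s t; decide

theorem linearIndependent_proj {φ : Dual (ZMod 2) V} {a : V} (ha : φ a = 1) {κ : Type*}
    [Fintype κ] {z : κ → Dual (ZMod 2) (LinearMap.ker φ)} (hz : LinearIndependent (ZMod 2) z) :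
    LinearIndependent (ZMod 2) (Sum.elim (fun _ : Unit => φ) fun k => (z k).comp (proj φ a ha)) :=
  linearIndependent_sum_comp (proj φ a ha) (proj_surjective ha) hz
    (fun _ : Unit => φ) (fun _ => a) (fun _ => proj_self ha) (by simp [ha])

theorem add_eq_form_mul {f : V → ZMod 2} {φ : Dual (ZMod 2) V} {a : V} (ha : φ a = 1) (x : V) :
    f x = f (proj φ a ha x) + φ x * (f (proj φ a ha x) + f (proj φ a ha x + a)) := by
  revert x
  refine forall_of_cosets ha (fun w => ?_) (fun w => ?_)
  · rw [proj_coe, apply_coe_ker, zero_mul, add_zero]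
  · rw [proj_coe_add, apply_coe_ker_add ha]
    linear_combination -add_self_zmod (f w)

/-- If the restriction of `f` to `ker φ` and some derivative of `f` across `φ` are flats, then `f`
is a sum of two flats. -/
theorem isKT_of_rep_derivative {s : ℕ} (hs : 2 ≤ s) {f : V → ZMod 2}
    (hw : weight f * 2 ^ (s + 1) < 2 * Fintype.card V) (hP : Primitive f)
    {φ : Dual (ZMod 2) V} {a : V} (ha : φ a = 1)
    (h0 : Rep (s + 1) (fun _ : Empty → ZMod 2 => 1) fun w : LinearMap.ker φ => f w)
    (h1 : Rep s (fun _ : Empty → ZMod 2 => 1) fun w : LinearMap.ker φ => f w + f (w + a)) :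
    IsKT (s + 1) f := by
  obtain ⟨z, c, hz, h0⟩ := h0
  obtain ⟨z', c', hz', h1⟩ := h1
  have hu := (linearIndependent_proj ha hz).comp (fun i : Fin (s + 1) => .inr (.inl i))
    fun i j h => by simpa using h
  let e : Fin (s + 1) → Unit ⊕ (Fin s ⊕ Empty) := Fin.cons (.inl ()) fun i => .inr (.inl i)
  have he : Function.Injective e := by
    intro i j
    refine Fin.cases ?_ (fun i => ?_) i <;> refine Fin.cases ?_ (fun j => ?_) j <;> simp [e]
  refine isKT_of_add_flats (by omega) hw hP hu ((linearIndependent_proj ha hz').comp e he)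
    (fun i => c (.inl i)) (Sum.elim (fun _ => 0) c' ∘ e) fun x => ?_
  rw [add_eq_form_mul (f := f) ha]
  dsimp only at h0 h1
  rw [h1, h0, Fin.prod_univ_succ (n := s) (fun i => (_ ∘ e) i + _)]
  simp [e]

end Primitive

section PrimitiveStep

variable {V : Type u} [AddCommGroup V] [Module (ZMod 2) V] [Fintype V]

/-- Derivatives of `f` across a hyperplane of minimal weight that are not flats have no affine
factor. -/
theorem derivative_cases {s : ℕ} {f : V → ZMod 2} {b : ℕ} (hP : Primitive f)
    {φ : Dual (ZMod 2) V} [Fintype (LinearMap.ker φ)] {a : V} (ha : φ a = 1)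
    (hb : weight (fun w : LinearMap.ker φ => f w) = b)
    (hbC : b * 2 ^ (s + 1) = Fintype.card (LinearMap.ker φ)) (hF : weight f < 4 * b)
    (hflat : IsFlat fun w : LinearMap.ker φ => f w) {n : ℕ}
    (hn : weight (fun w : LinearMap.ker φ => f w * f (w + a)) = n)
    (hsum : weight (fun w : LinearMap.ker φ => f w + f (w + a)) + 2 * n = weight f) {μ k : ℕ}
    (hμ : 2 ≤ μ)
    (hwt : weight (fun w : LinearMap.ker φ => f w + f (w + a)) * 2 ^ s * 2 ^ μ +
      2 * Fintype.card (LinearMap.ker φ) = 2 * Fintype.card (LinearMap.ker φ) * 2 ^ μ) :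
    2 * n < b ∧
      weight (fun w : LinearMap.ker φ => f w + f (w + a)) * 2 ^ μ + 4 * b = 4 * b * 2 ^ μ ∧
      ∀ {κ : Type} {G : (κ → ZMod 2) → ZMod 2},
        Rep k G (fun w : LinearMap.ker φ => f w + f (w + a)) → k = 0 := by
  have hpow : 0 < 2 ^ s := by positivity
  have h4 : 4 ≤ 2 ^ μ := by
    calc 4 = 2 ^ 2 := rfl
      _ ≤ 2 ^ μ := Nat.pow_le_pow_right (by norm_num) hμ
  have hwt' : weight (fun w : LinearMap.ker φ => f w + f (w + a)) * 2 ^ μ + 4 * b =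
      4 * b * 2 ^ μ := by
    rw [← hbC, pow_succ] at hwt
    refine Nat.eq_of_mul_eq_mul_right hpow ?_
    linear_combination hwt
  have hG : 3 * b ≤ weight (fun w : LinearMap.ker φ => f w + f (w + a)) := by
    have := three_mul_le_of_weight_eq
      (A := weight fun w : LinearMap.ker φ => f w + f (w + a)) (C := 2 * b)
      (by linear_combination hwt') h4
    omega
  have hnb : 2 * n < b := by omega
  refine ⟨hnb, hwt', fun {κ G} hrep => ?_⟩
  rcases k with _ | k
  · rfl
  exfalso
  obtain ⟨z, hz, c, hzero, -⟩ := hrep.hyperplaneWeight_eq_zero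
  obtain ⟨p, hpz, hp⟩ := hP.exists_ne_zero ha hz c
  have hpeq := hzero p hpz
  have hp1 : f p = 1 := by
    refine (eq_zero_or_one _).resolve_left fun h => ?_
    rw [h, zero_add] at hpeq
    rcases hp with hp | hp <;> contradiction
  have hle := weight_le_two_mul_hyperplaneWeight hflat hp1 z
  have hle2 : hyperplaneWeight (fun w : LinearMap.ker φ => f w) z (z p) ≤ n := by
    rw [← hn]
    refine sum_le_sum fun w _ => ?_
    have h := hzero w
    rw [hpz]
    revert h
    dsimp only
    generalize f w = s; generalize f (w + a) = t; generalize z w = q; generalize c = c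
    revert s t q c; decide
  omega

theorem false_of_constant_overlap {s b k G n F : ℕ} (hs : 2 ≤ s) (hb : b * 2 ^ (s + 1) = 2 ^ k)
    (hG : G * 2 ^ s + 4 * b = 4 * b * 2 ^ s) (hsum : G + 2 * n = F)
    (hF : 2 ^ (s + 1) * n + b = F) : False := by
  obtain ⟨R, hR⟩ : ∃ R, 2 ^ s = R + 1 := ⟨2 ^ s - 1, by have := Nat.one_le_two_pow (n := s); omega⟩
  have h4 : 4 ≤ R + 1 := by
    rw [← hR]
    calc 4 = 2 ^ 2 := rfl
      _ ≤ 2 ^ s := Nat.pow_le_pow_right (by norm_num) hs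
  rw [pow_succ, hR] at hF
  rw [hR] at hG
  have hdvd : (R : ℤ) ∣ b := by
    refine ⟨4 * b - b - 2 * n * (R + 1), ?_⟩
    zify at *
    linear_combination (R + 1 : ℤ) * hF - (R + 1 : ℤ) * hsum + hG
  have hdvd' : R ∣ 2 ^ k := (Int.natCast_dvd_natCast.1 hdvd).trans ⟨_, hb.symm⟩
  obtain ⟨j, -, hj⟩ := (Nat.dvd_prime_pow Nat.prime_two).1 hdvd'
  rcases j with _ | j
  · omega
  · obtain ⟨t, rfl⟩ : ∃ t, s = t + 1 := ⟨s - 1, by omega⟩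
    rw [pow_succ] at hj hR
    omega

/-- The classification for primitive functions, given a hyperplane of minimal weight. -/
theorem isKT_of_primitive (hV : ClassifiedBelow V) {s : ℕ} (hs : 2 ≤ s)
    {f : V → ZMod 2} (hf : DegreeLE (s + 1) f) (hw : weight f * 2 ^ (s + 1) < 2 * Fintype.card V)
    (hP : Primitive f) {φ : Dual (ZMod 2) V} [Fintype (LinearMap.ker φ)] {a : V} (ha : φ a = 1)
    (hmin : ∀ ψ : Dual (ZMod 2) V, ψ ≠ 0 → ∀ c,
      weight (fun w : LinearMap.ker φ => f w) ≤ hyperplaneWeight f ψ c) : IsKT (s + 1) f := by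
  obtain ⟨hrep, hbC⟩ := rep_of_hyperplaneWeight_min hV (by omega) hf hw hP ha hmin
  have hcard := card_eq_two_mul_card_ker ha
  have hCpos : 0 < Fintype.card (LinearMap.ker φ) := Fintype.card_pos
  obtain ⟨b, hb⟩ : ∃ b, weight (fun w : LinearMap.ker φ => f w) = b := ⟨_, rfl⟩
  rw [hb] at hbC
  have hF : weight f < 4 * b := by
    rw [hcard, ← hbC] at hw
    refine Nat.lt_of_mul_lt_mul_right (a := 2 ^ (s + 1)) ?_
    linarith
  by_cases hex : ∃ a', φ a' = 1 ∧
      Rep s (fun _ : Empty → ZMod 2 => 1) fun w : LinearMap.ker φ => f w + f (w + a')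
  · obtain ⟨a', ha', h1⟩ := hex
    exact isKT_of_rep_derivative hs hw hP ha' hrep h1
  exfalso
  push Not at hex
  obtain ⟨z, c, hz, h0⟩ := hrep
  simp only [mul_one] at h0
  have hflat : IsFlat fun w : LinearMap.ker φ => f w := by
    rw [funext h0]
    exact isFlat_prod _ _
  obtain ⟨p, hp⟩ : ∃ p : LinearMap.ker φ, f p = 1 := by
    obtain ⟨x, hx, hfx⟩ := hP φ (by rintro rfl; simp at ha) 0
    exact ⟨⟨x, hx⟩, hfx⟩
  have hsum (a' : V) (ha' : φ a' = 1) :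
      weight (fun w : LinearMap.ker φ => f w + f (w + a')) +
        2 * weight (fun w : LinearMap.ker φ => f w * f (w + a')) = weight f := by
    rw [weight_split ha' f]
    exact weight_add _ _
  have hkt (a' : V) (ha' : φ a' = 1) :
      IsKT s fun w : LinearMap.ker φ => f w + f (w + a') := by
    refine hV _ (by omega) s _ ?_ ?_ ?_
    · have := (hf a').comp (LinearMap.ker φ).subtype 0
      convert this using 1
      funext w
      simp [derivative, add_comm]
    · rw [Nat.pos_iff_ne_zero, Ne, weight_eq_zero]
      intro h
      obtain ⟨w, hw, hne⟩ := hP.exists_ne_zero ha' (hz.ne_zero (.inl 0)) (c (.inl 0))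
      have hw0 : f w = 0 := by
        rw [h0, prod_eq_zero (mem_univ 0)]
        rw [hw, add_self_zmod]
      have := h w
      rw [hw0, zero_add] at this
      rcases hne with hne | hne <;> contradiction
    · have h1 : weight (fun w : LinearMap.ker φ => f w + f (w + a')) ≤ weight f := by
        have := hsum a' ha'
        omega
      have h2 := Nat.mul_le_mul_right (2 ^ s) h1
      rw [pow_succ, ← mul_assoc] at hw
      omega
  have hcases (a' : V) (ha' : φ a' = 1) (n : ℕ)
      (hn : weight (fun w : LinearMap.ker φ => f w * f (w + a')) = n) :
      ∃ μ, 2 * n < b ∧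
        weight (fun w : LinearMap.ker φ => f w + f (w + a')) * 2 ^ μ + 4 * b = 4 * b * 2 ^ μ ∧
        ((3 ≤ s ∧ μ = s) ∨ (s = 2 ∧ 2 ≤ μ ∧
          Rep 0 (hyperbolic μ) fun w : LinearMap.ker φ => f w + f (w + a'))) := by
    have hsn := hsum a' ha'
    rw [hn] at hsn
    rcases hkt a' ha' with ⟨h, -⟩ | ⟨k, μ, h3, hk, hrep, hwt⟩ | ⟨k, μ, h2, hk, hrep, hwt⟩
    · exact absurd h (hex a' ha')
    · obtain ⟨h1, h2, h⟩ := derivative_cases (k := k) hP ha' hb hbC hF hflat hn hsn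
        (by omega) hwt
      have := h hrep
      exact ⟨μ, h1, h2, .inl (by omega)⟩
    · obtain ⟨h1, h2', h⟩ := derivative_cases (k := k) hP ha' hb hbC hF hflat hn hsn h2 hwt
      obtain rfl := h hrep
      exact ⟨μ, h1, h2', .inr ⟨by omega, h2, hrep⟩⟩
  have hφ (h : LinearMap.ker φ) : φ (a + h) = 1 := by rw [map_add, ha, apply_coe_ker, add_zero]
  have hdouble := sum_overlap (f := f) ha
  rw [hb] at hdouble
  rcases (show 3 ≤ s ∨ s = 2 by omega) with hs3 | rfl
  · obtain ⟨k, hk⟩ : ∃ k, Fintype.card (LinearMap.ker φ) = 2 ^ k := by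
      refine ⟨finrank (ZMod 2) (LinearMap.ker φ), ?_⟩
      rw [Module.card_eq_pow_finrank (K := ZMod 2), ZMod.card]
    obtain ⟨n, hn⟩ : ∃ n, weight (fun w : LinearMap.ker φ => f w * f (w + a)) = n := ⟨_, rfl⟩
    have hG (a' : V) (ha' : φ a' = 1) :
        weight (fun w : LinearMap.ker φ => f w + f (w + a')) * 2 ^ s + 4 * b = 4 * b * 2 ^ s := by
      obtain ⟨μ, -, h, ⟨-, rfl⟩ | ⟨h2, -⟩⟩ := hcases a' ha' _ rfl
      · exact h
      · omega
    have hconst (h : LinearMap.ker φ) :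
        weight (fun w : LinearMap.ker φ => f w * f (w + (a + h))) = n := by
      have h1 := hG a ha
      have h2 := hG _ (hφ h)
      have h3 := hsum a ha
      have h4 := hsum _ (hφ h)
      have h5 := Nat.eq_of_mul_eq_mul_right (by positivity)
        (Nat.add_right_cancel (h1.trans h2.symm))
      omega
    simp only [hconst, sum_const, card_univ, smul_eq_mul] at hdouble
    refine false_of_constant_overlap (n := n) (F := weight f) hs (hbC.trans hk) (hG a ha) ?_ ?_
    · rw [← hn]; exact hsum a ha
    · have hbpos : 0 < b := by omega
      rw [← hbC] at hdouble
      refine Nat.eq_of_mul_eq_mul_left hbpos ?_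
      linear_combination hdouble
  · obtain ⟨h, hh⟩ : ∃ h : LinearMap.ker φ, weight f ≤
        8 * weight (fun w : LinearMap.ker φ => f w * f (w + (a + h))) + b := by
      by_contra! hlt
      have hbpos : 0 < b := by omega
      have h1 := sum_lt_sum_of_nonempty (univ_nonempty (α := LinearMap.ker φ))
        fun h _ => hlt h
      rw [sum_add_distrib, ← mul_sum, sum_const, sum_const, card_univ, smul_eq_mul,
        smul_eq_mul, ← hbC, show (2 : ℕ) ^ (2 + 1) = 8 from rfl] at h1
      linarith
    obtain ⟨n, hn⟩ : ∃ n, weight (fun w : LinearMap.ker φ => f w * f (w + (a + h))) = n :=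
      ⟨_, rfl⟩
    rw [hn] at hh
    have hsn := hsum _ (hφ h)
    obtain ⟨μ, h1, h2, ⟨h3, -⟩ | ⟨-, h3, hrep⟩⟩ := hcases _ (hφ h) _ hn
    · omega
    rw [hn] at hsn
    have hμ : μ = 2 := by
      by_contra hne
      have := seven_mul_le_of_weight_eq
        (A := weight fun w : LinearMap.ker φ => f w + f (w + (a + h))) (C := 2 * b)
        (by linear_combination h2) (M := 2 ^ μ)
        (by calc 8 = 2 ^ 3 := rfl
              _ ≤ 2 ^ μ := Nat.pow_le_pow_right (by norm_num) (by omega))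
      omega
    subst hμ
    obtain ⟨z', c', -, hg⟩ := hrep
    refine not_quadric_vanishing_between (n := n) hflat hp (z' (.inr (.inl 0))) (z' (.inr (.inr 0)))
      (z' (.inr (.inl 1))) (z' (.inr (.inr 1))) (c' (.inr (.inl 0))) (c' (.inr (.inr 0)))
      (c' (.inr (.inl 1))) (c' (.inr (.inr 1))) ?_ (by omega) (by omega)
    rw [← hn]
    refine sum_congr rfl fun w _ => ?_
    have := hg w
    simp only [hyperbolic, univ_eq_empty, prod_empty, one_mul, Fin.sum_univ_two] at this
    rw [← this]
    dsimp only
    generalize f w = s; generalize f _ = t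
    revert s t; decide

end PrimitiveStep

section Classification

theorem isKT_of_degreeLE (N : ℕ) : ∀ (V : Type u) [AddCommGroup V] [Module (ZMod 2) V] [Fintype V],
    Fintype.card V = N → ∀ (r : ℕ) (f : V → ZMod 2), DegreeLE r f → 0 < weight f →
      weight f * 2 ^ r < 2 * Fintype.card V → IsKT r f := by
  induction N using Nat.strong_induction_on with
  | _ N ih =>
  intro V _ _ _ hN r f hf hf0 hw
  have hV : ClassifiedBelow V := fun W _ _ _ hW => ih _ (hN ▸ hW) W rfl
  rcases r with _ | _ | _ | s
  · exact isKT_zero hf hf0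
  · exact isKT_one hV hf hf0 hw
  · exact isKT_two hV hf hf0 hw
  by_cases hP : Primitive f
  · have hex : ∃ n, ∃ φ : Dual (ZMod 2) V, φ ≠ 0 ∧ ∃ c, hyperplaneWeight f φ c = n := by
      have hnt : Nontrivial V := by
        rw [← Fintype.one_lt_card_iff_nontrivial]
        have h8 : 2 ^ 1 ≤ 2 ^ (s + 1 + 1 + 1) := Nat.pow_le_pow_right (by norm_num) (by omega)
        nlinarith
      obtain ⟨φ, hφ⟩ := exists_ne (0 : Dual (ZMod 2) V)
      exact ⟨_, φ, hφ, 0, rfl⟩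
    classical
    obtain ⟨φ, hφ, c, hc⟩ := Nat.find_spec hex
    obtain ⟨a, ha⟩ := exists_apply_eq_one hφ
    have hmin (ψ : Dual (ZMod 2) V) (hψ : ψ ≠ 0) (d) :
        hyperplaneWeight f φ c ≤ hyperplaneWeight f ψ d := by
      rw [hc]
      exact Nat.find_min' hex ⟨ψ, hψ, d, rfl⟩
    have := Fintype.ofFinite (LinearMap.ker φ)
    rw [← isKT_translate_iff (c • a)]
    rw [← weight_translate f (c • a)] at hw
    refine isKT_of_primitive hV (s := s + 2) (by omega) (hf.translate _) hw ?_ ha ?_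
    · intro ψ hψ d
      obtain ⟨x, hx, hfx⟩ := hP ψ hψ (d + ψ (c • a))
      refine ⟨x + c • a, ?_, ?_⟩
      · rw [map_add, hx]
        linear_combination add_self_zmod (ψ (c • a))
      · simpa only [add_assoc, add_self_module, add_zero] using hfx
    · intro ψ hψ d
      have h := hyperplaneWeight_eq_weight_ker (fun x => f (x + c • a)) ha
      rw [← h, hyperplaneWeight_translate, hyperplaneWeight_translate, map_smul, ha, smul_eq_mul,
        mul_one, zero_add]
      exact hmin ψ hψ _
  · simp only [Primitive] at hP
    push Not at hP
    obtain ⟨φ, hφ, c, h⟩ := hP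
    exact isKT_of_vanishing hV hf hf0 hw hφ c fun x hx =>
      (eq_zero_or_one _).resolve_right (h x hx)

end Classification

section Coordinates

theorem wt_eq_weight {m : ℕ} (P : Fn m) : wt m P = weight P := by
  rw [wt, card_filter, weight]
  refine sum_congr rfl fun u _ => ?_
  generalize P u = t
  revert t; decide

theorem card_point (m : ℕ) : Fintype.card (Point m) = 2 ^ m := by simp

theorem degreeLE_monFn {m : ℕ} (S : Finset (Fin m)) : DegreeLE S.card (monFn m S) := by
  induction S using Finset.induction_on with
  | empty => exact degreeLE_const 0 1
  | insert i S hi ih =>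
    rw [card_insert_of_notMem hi]
    convert ih.mul_form (LinearMap.proj i) using 1
    funext u
    rw [monFn, prod_insert hi]
    rfl

theorem degreeLE_of_degLE {m r : ℕ} {P : Fn m} (h : degLE m P r) : DegreeLE r P := by
  refine Submodule.span_induction ?_ ?_ ?_ ?_ h
  · rintro _ ⟨S, hS, rfl⟩
    exact (degreeLE_monFn S).mono hS
  · exact degreeLE_const r 0
  · exact fun P Q _ _ hP hQ => hP.add hQ
  · intro t P _ hP
    rcases eq_zero_or_one t with rfl | rfl
    · rw [zero_smul]
      exact degreeLE_const r 0
    · rwa [one_smul]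

/-- Independent affine functions in coordinates, listed in the order given by `ν`. -/
theorem exists_affForm {m N : ℕ} {ι : Type*} [Fintype ι] {z : ι → Dual (ZMod 2) (Point m)}
    (hz : LinearIndependent (ZMod 2) z) (c : ι → ZMod 2) {ν : ι → ℕ} (hν : Function.Injective ν)
    (hlt : ∀ i, ν i < N) (hN : Fintype.card ι = N) :
    N ≤ m ∧ ∃ (c' : ℕ → ZMod 2) (a : ℕ → Point m),
      LinearIndependent (ZMod 2) (fun j : Fin N => a j.1) ∧
      ∀ i u, affForm m (c' (ν i)) (a (ν i)) u = c i + z i u := by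
  let e : ι ≃ Fin N := Equiv.ofBijective (fun i => ⟨ν i, hlt i⟩)
    ((Fintype.bijective_iff_injective_and_card _).2
      ⟨fun i j h => hν (congrArg Fin.val h), by rw [hN, Fintype.card_fin]⟩)
  let T : Dual (ZMod 2) (Point m) →ₗ[ZMod 2] Point m :=
    LinearMap.pi fun i => LinearMap.applyₗ (Pi.single i 1)
  have hT : LinearMap.ker T = ⊥ := by
    rw [LinearMap.ker_eq_bot']
    intro φ hφ
    refine LinearMap.pi_ext' fun i => LinearMap.ext_ring ?_
    exact congrFun hφ i
  have hli : LinearIndependent (ZMod 2) fun j : Fin N => T (z (e.symm j)) :=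
    (hz.map' T hT).comp _ e.symm.injective
  refine ⟨by simpa using hli.fintype_card_le_finrank,
    fun j => if h : j < N then c (e.symm ⟨j, h⟩) else 0,
    fun j => if h : j < N then T (z (e.symm ⟨j, h⟩)) else 0, ?_, fun i u => ?_⟩
  · simpa using hli
  · have he : e.symm ⟨ν i, hlt i⟩ = i := e.symm_apply_eq.2 rfl
    simp only [affForm, hlt, dif_pos, he]
    rw [LinearMap.pi_apply_eq_sum_univ (z i) u]
    congr 1
    refine sum_congr rfl fun j _ => ?_
    rw [smul_eq_mul, mul_comm]
    congr 1
    refine congrArg (z i) (funext fun l => ?_)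
    rw [Pi.single_apply]
    simp only [eq_comm]

theorem eq_sub_of_weight_eq {m r μ A : ℕ} (h : r + μ ≤ m)
    (hA : A * 2 ^ r * 2 ^ μ + 2 * 2 ^ m = 2 * 2 ^ m * 2 ^ μ) :
    A = 2 ^ (m + 1 - r) - 2 ^ (m + 1 - r - μ) := by
  obtain ⟨t, rfl⟩ := Nat.exists_eq_add_of_le h
  rw [show r + μ + t + 1 - r = μ + (t + 1) by omega, Nat.add_sub_cancel_left]
  refine Nat.eq_sub_of_add_eq (Nat.eq_of_mul_eq_mul_right (m := 2 ^ r * 2 ^ μ) (by positivity) ?_)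
  rw [pow_add, pow_add] at hA
  rw [pow_add, pow_succ]
  linear_combination hA

end Coordinates

end KasamiTokura

/-- Kasami–Tokura classification below twice the minimum weight. -/
theorem stmt7 (m r : ℕ) (hm : 1 ≤ m) (hr : r < m) (P : Fn m)
    (hdeg : degLE m P r) (hw0 : 0 < wt m P) (hw1 : wt m P < 2 ^ (m + 1 - r)) :
    (∃ (c : ℕ → ZMod 2) (a : ℕ → Point m),
        LinearIndependent (ZMod 2) (fun j : Fin r => a j.1) ∧
        P = ∏ j ∈ Finset.range r, affForm m (c j) (a j) ∧
        wt m P = 2 ^ (m - r)) ∨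
    (∃ μ : ℕ, 3 ≤ μ ∧ μ ≤ r ∧ r + μ ≤ m ∧
      ∃ (c : ℕ → ZMod 2) (a : ℕ → Point m),
        LinearIndependent (ZMod 2) (fun j : Fin (r + μ) => a j.1) ∧
        P = (∏ j ∈ Finset.range (r - μ), affForm m (c j) (a j)) *
            ((∏ j ∈ Finset.Ico (r - μ) r, affForm m (c j) (a j)) +
              ∏ j ∈ Finset.Ico r (r + μ), affForm m (c j) (a j)) ∧
        wt m P = 2 ^ (m + 1 - r) - 2 ^ (m + 1 - r - μ)) ∨
    (∃ μ : ℕ, 2 ≤ μ ∧ 2 * μ ≤ m - r + 2 ∧ 2 ≤ r ∧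
      ∃ (c : ℕ → ZMod 2) (a : ℕ → Point m),
        LinearIndependent (ZMod 2) (fun j : Fin (r + 2 * μ - 2) => a j.1) ∧
        P = (∏ j ∈ Finset.range (r - 2), affForm m (c j) (a j)) *
            (∑ k ∈ Finset.range μ,
              affForm m (c (r - 2 + 2 * k)) (a (r - 2 + 2 * k)) *
                affForm m (c (r - 2 + 2 * k + 1)) (a (r - 2 + 2 * k + 1))) ∧
        wt m P = 2 ^ (m + 1 - r) - 2 ^ (m + 1 - r - μ)) := by
  classical
  rw [KasamiTokura.wt_eq_weight] at hw0 hw1 ⊢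
  have hlt : KasamiTokura.weight P * 2 ^ r < 2 * Fintype.card (Point m) := by
    calc KasamiTokura.weight P * 2 ^ r < 2 ^ (m + 1 - r) * 2 ^ r :=
          Nat.mul_lt_mul_of_pos_right hw1 (by positivity)
      _ = 2 * Fintype.card (Point m) := by
          rw [KasamiTokura.card_point, ← pow_add, Nat.sub_add_cancel (by omega), pow_succ, mul_comm]
  rcases KasamiTokura.isKT_of_degreeLE _ (Point m) rfl r P (KasamiTokura.degreeLE_of_degLE hdeg)
    hw0 hlt with ⟨⟨z, c, hz, h⟩, hw⟩ | ⟨k, μ, hμ, rfl, ⟨z, c, hz, h⟩, hw⟩ |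
      ⟨k, μ, hμ, rfl, ⟨z, c, hz, h⟩, hw⟩ <;>
    rw [KasamiTokura.card_point] at hw
  · left
    obtain ⟨-, c', a, hli, ha⟩ := KasamiTokura.exists_affForm (N := r) hz c
      (ν := Sum.elim (fun i => i.1) fun i => i.elim)
      (by rintro (i | i) (j | j) hij
          · exact congrArg _ (Fin.ext hij)
          · exact j.elim
          · exact i.elim
          · exact i.elim)
      (by rintro (i | i)
          · exact i.2
          · exact i.elim)
      (by simp)
    refine ⟨c', a, hli, ?_, ?_⟩
    · funext u
      rw [h, mul_one, Finset.prod_apply, Finset.prod_range]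
      exact prod_congr rfl fun i _ => (ha (.inl i) u).symm
    · refine Nat.eq_of_mul_eq_mul_right (m := 2 ^ r) (by positivity) ?_
      rw [hw, pow_sub_mul_pow 2 hr.le]
  · right; left
    obtain ⟨hle, c', a, hli, ha⟩ := KasamiTokura.exists_affForm (N := k + μ + μ) hz c
      (ν := Sum.elim (fun i => i.1) (Sum.elim (fun i => k + i.1) fun i => k + μ + i.1))
      (by rintro (i | i | i) (j | j | j) hij <;>
            simp only [Sum.elim_inl, Sum.elim_inr] at hij <;>
            first
            | omega
            | (congr 2; omega))
      (by rintro (i | i | i) <;> simp only [Sum.elim_inl, Sum.elim_inr] <;> omega)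
      (by simp; omega)
    refine ⟨μ, hμ, by omega, hle, c', a, hli, ?_, KasamiTokura.eq_sub_of_weight_eq hle hw⟩
    funext u
    rw [h, Nat.add_sub_cancel, Pi.mul_apply, Pi.add_apply, Finset.prod_apply, Finset.prod_apply,
      Finset.prod_apply, prod_Ico_eq_prod_range, prod_Ico_eq_prod_range, Nat.add_sub_cancel_left,
      Nat.add_sub_cancel_left, Finset.prod_range, Finset.prod_range, Finset.prod_range]
    simp only [KasamiTokura.twoProd, ← ha, Sum.elim_inl, Sum.elim_inr]
  · right; right
    obtain ⟨hle, c', a, hli, ha⟩ := KasamiTokura.exists_affForm (N := k + 2 + 2 * μ - 2) hz c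
      (ν := Sum.elim (fun i => i.1) (Sum.elim (fun i => k + 2 * i.1) fun i => k + 2 * i.1 + 1))
      (by rintro (i | i | i) (j | j | j) hij <;>
            simp only [Sum.elim_inl, Sum.elim_inr] at hij <;>
            first
            | omega
            | (congr 2; omega))
      (by rintro (i | i | i) <;> simp only [Sum.elim_inl, Sum.elim_inr] <;> omega)
      (by simp; omega)
    refine ⟨μ, hμ, by omega, by omega, c', a, hli, ?_,
      KasamiTokura.eq_sub_of_weight_eq (by omega) hw⟩
    funext u
    rw [h, Nat.add_sub_cancel, Pi.mul_apply, Finset.prod_apply, Finset.sum_apply,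
      Finset.prod_range, Finset.sum_range]
    simp only [KasamiTokura.hyperbolic, ← ha, Sum.elim_inl, Sum.elim_inr, Pi.mul_apply]
end
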